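/- arXiv:1903.02415 — 2 statements merged into one kernel-verified Lean document; each statement's English description precedes it below -/
import Mathlib

section
/- Assume 0 < q < 1, N = -λ₁-α₁ ∈ ℤ_{≥0}, β < 1, α₂-α₁ < 1, t₁ > 0, t₂ > 0, h₁ < h₂, l₁ < l₂, together with 1+h₂-l₂-β > 0 and 2+2h₂-l₁-l₂-β > 0. Then the spectral polynomial c_{N+1}(E) of the q-Heun equation satisfies c_{N+1}(E) ~ (t₁t₂)^{-N-1} q^{(N/2+λ₁-h₁-h₂)(N+1)} ∏_{m=0}^{N} (E + q^{1/2-m+h₁-λ₁} t₁) as q → +0 (equivalence of polynomials coefficient-wise), and consequently its roots E_1(q) < ⋯ < E_{N+1}(q) satisfy E_k(q) ~ -q^{k-N-1/2+h₁-λ₁} t₁. -/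
open Polynomial Filter Set

lemma aux_factor (m : ℕ) (p : ℝ[X]) (hd : p.natDegree = m) (hlc : 0 < p.leadingCoeff)
    (s : ℕ → ℝ) (hs : ∀ i j, i < j → j < m → s i < s j) (hr : ∀ i, i < m → p.eval (s i) = 0) :
    p = C p.leadingCoeff * ∏ i ∈ Finset.range m, (X - C (s i)) := by
  have hp : p ≠ 0 := by rintro rfl; simp at hlc
  have hinj : Set.InjOn s (Finset.range m : Set ℕ) := by
    intro i hi j hj h
    simp at hi hj
    rcases lt_trichotomy i j with h1 | h1 | h1
    · exact absurd h (hs i j h1 hj).ne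
    · exact h1
    · exact absurd h (hs j i h1 hi).ne'
  have hsub : ((Finset.range m).image s).val ≤ p.roots := by
    rw [Finset.val_le_iff_val_subset]
    intro x hx
    simp only [Finset.mem_val, Finset.mem_image, Finset.mem_range] at hx
    obtain ⟨i, hi, rfl⟩ := hx
    rw [mem_roots hp]; exact hr i hi
  have hcard : ((Finset.range m).image s).card = m := by
    rw [Finset.card_image_of_injOn hinj, Finset.card_range]
  have heq : ((Finset.range m).image s).val = p.roots := by
    apply Multiset.eq_of_le_of_card_le hsub
    rw [Finset.card_val, hcard, ← hd]; exact card_roots' p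
  have := C_leadingCoeff_mul_prod_multiset_X_sub_C (p := p) (by
    rw [← heq, Finset.card_val, hcard, hd])
  conv_lhs => rw [← this]
  congr 1
  rw [← heq, ← Finset.prod_image hinj (f := fun a => X - C a)]
  rfl

lemma aux_sign (m i : ℕ) (hi : i ≤ m) (s : ℕ → ℝ) (x : ℝ) (h1 : ∀ j, j < i → s j < x)
    (h2 : ∀ j, i ≤ j → j < m → x < s j) :
    0 < (-1 : ℝ) ^ (m - i) * ∏ j ∈ Finset.range m, (x - s j) := by
  obtain ⟨k, rfl⟩ := Nat.exists_eq_add_of_le hi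
  rw [Finset.prod_range_add, Nat.add_sub_cancel_left]
  have e : (-1 : ℝ) ^ k * ((∏ j ∈ Finset.range i, (x - s j)) *
      ∏ j ∈ Finset.range k, (x - s (i + j))) = (∏ j ∈ Finset.range i, (x - s j)) *
      ∏ j ∈ Finset.range k, (s (i + j) - x) := by
    have : ∏ j ∈ Finset.range k, (s (i + j) - x) =
      (-1 : ℝ) ^ k * ∏ j ∈ Finset.range k, (x - s (i + j)) := by
      rw [← Finset.card_range k, ← Finset.prod_const, Finset.card_range, ← Finset.prod_mul_distrib]
      exact Finset.prod_congr rfl fun j _ => by ring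
    rw [this]; ring
  rw [e]
  apply mul_pos
  · exact Finset.prod_pos fun j hj => sub_pos.2 (h1 j (Finset.mem_range.1 hj))
  · exact Finset.prod_pos fun j hj => sub_pos.2 (h2 _ (by omega)
      (by have := Finset.mem_range.1 hj; omega))

lemma aux_ivt (p : ℝ[X]) (a b : ℝ) (hab : a < b) (h : p.eval a * p.eval b < 0) :
    ∃ x, a < x ∧ x < b ∧ p.eval x = 0 := by
  have hc : ContinuousOn (fun x => p.eval x) (Icc a b) := p.continuous.continuousOn
  rcases mul_neg_iff.1 h with ⟨h1, h2⟩ | ⟨h1, h2⟩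
  · obtain ⟨x, hx, e⟩ := intermediate_value_Ioo' hab.le hc (show (0:ℝ) ∈ _ from ⟨h2, h1⟩)
    exact ⟨x, hx.1, hx.2, e⟩
  · obtain ⟨x, hx, e⟩ := intermediate_value_Ioo hab.le hc (show (0:ℝ) ∈ _ from ⟨h1, h2⟩)
    exact ⟨x, hx.1, hx.2, e⟩

lemma aux_top (p : ℝ[X]) (hd : 0 < p.natDegree) (hlc : 0 < p.leadingCoeff) (b : ℝ) :
    ∃ x, b < x ∧ 0 < p.eval x := by
  have h := p.tendsto_atTop_of_leadingCoeff_nonneg (natDegree_pos_iff_degree_pos.1 hd) hlc.le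
  obtain ⟨x, h1, h2⟩ := ((h.eventually_gt_atTop 0).and (eventually_gt_atTop b)).exists
  exact ⟨x, h2, h1⟩

lemma aux_bot (p : ℝ[X]) (hd : 0 < p.natDegree) (hlc : 0 < p.leadingCoeff) (b : ℝ) :
    ∃ x, x < b ∧ 0 < (-1) ^ p.natDegree * p.eval x := by
  have hn : (C ((-1 : ℝ) ^ p.natDegree) * p.comp (-X)).natDegree = p.natDegree := by
    rw [natDegree_C_mul (by simp), natDegree_comp]; simp
  have hl : (C ((-1 : ℝ) ^ p.natDegree) * p.comp (-X)).leadingCoeff = p.leadingCoeff := by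
    rw [leadingCoeff_mul, leadingCoeff_comp (by simp)]
    simp only [leadingCoeff_C, leadingCoeff_neg, leadingCoeff_X]
    rw [mul_left_comm, ← mul_pow]; simp
  obtain ⟨x, h1, h2⟩ := aux_top _ (hn ▸ hd) (hl ▸ hlc) (-b)
  refine ⟨-x, by linarith, ?_⟩
  simpa using h2

lemma aux_interlace (M : ℕ) (p : ℕ → ℝ[X]) (A U B D : ℕ → ℝ) (hp0 : p 0 = 1)
    (hA : ∀ n, 1 ≤ n → n ≤ M → 0 < A n) (hU : ∀ n, 1 ≤ n → n ≤ M → 0 < U n)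
    (hD : ∀ n, 2 ≤ n → n ≤ M → 0 < D n)
    (hp1 : p 1 * C (A 1) = p 0 * (X * C (U 1) + C (B 1)))
    (hp : ∀ n, 2 ≤ n → p n * C (A n) = p (n - 1) * (X * C (U n) + C (B n)) - p (n - 2) * C (D n)) :
    ∀ n, n + 1 ≤ M → (p n).natDegree ≤ n ∧ (p (n+1)).natDegree = n + 1 ∧
      0 < (p (n+1)).leadingCoeff ∧
      ∃ r : ℕ → ℝ, (∀ i j, i < j → j < n + 1 → r i < r j) ∧
        (∀ i, i < n + 1 → (p (n+1)).eval (r i) = 0) ∧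
        (∀ i, i < n + 1 → 0 < (-1) ^ (n - i) * (p n).eval (r i)) := by
  intro n
  induction n with
  | zero =>
    intro h
    have hA1 := hA 1 le_rfl h
    have hU1 := hU 1 le_rfl h
    have e : p 1 = C (U 1 / A 1) * X + C (B 1 / A 1) := by
      have : p 1 = p 1 * C (A 1) * C (A 1)⁻¹ := by
        rw [mul_assoc, ← C_mul, mul_inv_cancel₀ hA1.ne']; simp
      rw [this, hp1, hp0, div_eq_mul_inv, div_eq_mul_inv, C_mul, C_mul]; ring
    have hne : U 1 / A 1 ≠ 0 := (div_pos hU1 hA1).ne'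
    refine ⟨by simp [hp0], ?_, ?_, fun _ => - B 1 / U 1, ?_, ?_, ?_⟩
    · rw [e]; exact natDegree_linear hne
    · rw [e, leadingCoeff_linear hne]; exact div_pos hU1 hA1
    · intro i j h1 h2; omega
    · intro i hi; rw [e]; simp; field_simp; ring
    · intro i hi; simp [hp0]
  | succ n ih =>
    intro h
    obtain ⟨hdn, hd, hl, r, hr, hr0, hrs⟩ := ih (by omega)
    have hA2 := hA (n+2) (by omega) h
    have hU2 := hU (n+2) (by omega) h
    have hD2 := hD (n+2) (by omega) h
    have hrec := hp (n+2) (by omega)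
    simp only [show n + 2 - 1 = n + 1 by omega, show n + 2 - 2 = n by omega] at hrec
    have e : p (n+2) = C (A (n+2))⁻¹ * (p (n+1) * (C (U (n+2)) * X + C (B (n+2))) - p n * C (D (n+2))) := by
      have : p (n+2) = p (n+2) * C (A (n+2)) * C (A (n+2))⁻¹ := by
        rw [mul_assoc, ← C_mul, mul_inv_cancel₀ hA2.ne']; simp
      rw [this, hrec]; ring
    have hlin : (C (U (n+2)) * X + C (B (n+2))).natDegree = 1 := natDegree_linear hU2.ne'
    have hlin0 : (C (U (n+2)) * X + C (B (n+2))) ≠ 0 := by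
      intro h0; rw [h0] at hlin; simp at hlin
    have hpn0 : p (n+1) ≠ 0 := by intro h0; rw [h0] at hl; simp at hl
    have hq : (p (n+1) * (C (U (n+2)) * X + C (B (n+2)))).natDegree = n + 2 := by
      rw [natDegree_mul hpn0 hlin0, hd, hlin]
    have hlt : (p n * C (D (n+2))).natDegree <
        (p (n+1) * (C (U (n+2)) * X + C (B (n+2)))).natDegree := by
      rw [hq]; exact lt_of_le_of_lt (natDegree_mul_C_le _ _) (by omega)
    have hd2 : (p (n+2)).natDegree = n + 2 := by
      rw [e, natDegree_C_mul (inv_ne_zero hA2.ne'), natDegree_sub_eq_left_of_natDegree_lt hlt, hq]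
    have hl2 : 0 < (p (n+2)).leadingCoeff := by
      rw [e, leadingCoeff_mul, leadingCoeff_C,
        leadingCoeff_sub_of_degree_lt (degree_lt_degree hlt), leadingCoeff_mul,
        leadingCoeff_linear hU2.ne']
      positivity
    have hev : ∀ i, i < n + 1 → 0 < (-1) ^ (n + 1 - i) * (p (n+2)).eval (r i) := by
      intro i hi
      have h1 := hrs i hi
      rw [e]
      simp only [eval_mul, eval_sub, eval_C, hr0 i hi]
      rw [show n + 1 - i = (n - i) + 1 by omega, pow_succ]
      have : 0 < (A (n+2))⁻¹ * D (n+2) * ((-1) ^ (n - i) * (p n).eval (r i)) := by positivity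
      linarith
    obtain ⟨xt, hxt, hxt2⟩ := aux_top (p (n+2)) (by omega) hl2 (r n)
    obtain ⟨xb, hxb, hxb2⟩ := aux_bot (p (n+2)) (by omega) hl2 (r 0)
    rw [hd2] at hxb2
    -- points y
    let y : ℕ → ℝ := fun i => if i = 0 then xb else if i = n + 2 then xt else r (i - 1)
    have hy1 : ∀ i, i < n + 2 → y i < y (i+1) := by
      intro i hi
      simp only [y]
      rcases Nat.eq_zero_or_pos i with rfl | hi0
      · simpa using hxb
      · rcases Nat.lt_or_ge i (n+1) with h1 | h1
        · rw [if_neg (by omega), if_neg (by omega), if_neg (by omega), if_neg (by omega)]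
          exact hr _ _ (by omega) (by omega)
        · obtain rfl : i = n + 1 := by omega
          simpa using hxt
    have hy2 : ∀ i, i < n + 3 → 0 < (-1) ^ (n + 2 - i) * (p (n+2)).eval (y i) := by
      intro i hi
      simp only [y]
      rcases Nat.eq_zero_or_pos i with rfl | hi0
      · simpa using hxb2
      · rcases Nat.lt_or_ge i (n+2) with h1 | h1
        · rw [if_neg (by omega), if_neg (by omega)]
          have := hev (i-1) (by omega)
          rwa [show n + 1 - (i - 1) = n + 2 - i by omega] at this
        · obtain rfl : i = n + 2 := by omega
          simpa using hxt2
    have hz : ∀ i, ∃ x, i < n + 2 → y i < x ∧ x < y (i+1) ∧ (p (n+2)).eval x = 0 := by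
      intro i
      by_cases hi : i < n + 2
      · obtain ⟨x, hx⟩ := aux_ivt (p (n+2)) _ _ (hy1 i hi) (by
          have h1 := hy2 i (by omega)
          have h2 := hy2 (i+1) (by omega)
          rw [show n + 2 - i = (n + 2 - (i+1)) + 1 by omega, pow_succ] at h1
          rcases neg_one_pow_eq_or ℝ (n + 2 - (i+1)) with h3 | h3 <;> rw [h3] at h1 h2 <;> nlinarith)
        exact ⟨x, fun _ => hx⟩
      · exact ⟨0, fun h => absurd h hi⟩
    choose s hs using hz
    have hymono : ∀ i k, i + k < n + 3 → y i ≤ y (i + k) := by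
      intro i k
      induction k with
      | zero => intro _; exact le_rfl
      | succ k ihk => intro hk; exact (ihk (by omega)).trans (hy1 (i+k) (by omega)).le
    have hsy : ∀ i j, i < j → j < n + 2 → s i < y j := by
      intro i j hij hj
      obtain ⟨k, rfl⟩ := Nat.exists_eq_add_of_lt hij
      have := hymono (i+1) k (by omega)
      rw [show i + 1 + k = i + k + 1 by omega] at this
      exact (hs i (by omega)).2.1.trans_le this
    refine ⟨hd.le, hd2, hl2, s, ?_, fun i hi => (hs i hi).2.2, ?_⟩
    · intro i j hij hj
      exact (hsy i j hij hj).trans (hs j hj).1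
    · intro i hi
      have hf := aux_factor (n+1) (p (n+1)) hd hl r hr hr0
      rw [hf, eval_mul, eval_C, eval_prod]
      simp only [eval_sub, eval_X, eval_C]
      have hry : ∀ j, j < n + 1 → r j = y (j+1) := by
        intro j hj; simp only [y]
        rw [if_neg (by omega), if_neg (by omega)]; rfl
      have := aux_sign (n+1) i (by omega) r (s i) (by
        intro j hj
        rw [hry j (by omega)]
        obtain ⟨k, rfl⟩ := Nat.exists_eq_add_of_lt hj
        have := hymono (j+1) k (by omega)
        rw [show j + 1 + k = j + k + 1 by omega] at this
        exact this.trans_lt (hs _ hi).1) (by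
        intro j hj hj2
        rw [hry j hj2]
        exact hsy i (j+1) (by omega) (by omega))
      have h3 := mul_pos hl this
      linarith

open Asymptotics in
lemma aux_add {l : Filter ℝ} {f g v w : ℝ → ℝ} (hv : ∀ᶠ x in l, 0 ≤ v x) (hw : ∀ᶠ x in l, 0 ≤ w x)
    (hf : f ~[l] v) (hg : g ~[l] w) : (fun x => f x + g x) ~[l] (fun x => v x + w x) := by
  have h1 : v =O[l] (fun x => v x + w x) := by
    apply IsBigO.of_bound 1
    filter_upwards [hv, hw] with x h1 h2
    rw [Real.norm_eq_abs, Real.norm_eq_abs, abs_of_nonneg h1, abs_of_nonneg (by positivity)]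
    linarith
  have h2 : w =O[l] (fun x => v x + w x) := by
    apply IsBigO.of_bound 1
    filter_upwards [hv, hw] with x h1 h2
    rw [Real.norm_eq_abs, Real.norm_eq_abs, abs_of_nonneg h2, abs_of_nonneg (by positivity)]
    linarith
  have := (hf.isLittleO.trans_isBigO h1).add (hg.isLittleO.trans_isBigO h2)
  refine this.congr_left ?_
  intro x; simp; ring

noncomputable def auxT (A v : ℝ) (u : ℕ → ℝ) : ℕ → ℝ[X]
  | 0 => 1
  | n + 1 => C A⁻¹ * (auxT A v u n * (X * C (u (n+1)) + C v))

lemma auxT_coeff (A v : ℝ) (u : ℕ → ℝ) (n j : ℕ) :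
    (auxT A v u (n+1)).coeff j = (u (n+1) * (auxT A v u n * X).coeff j + v * (auxT A v u n).coeff j) / A := by
  rw [auxT, coeff_C_mul, mul_add, ← mul_assoc, coeff_add, coeff_mul_C, coeff_mul_C]
  ring

lemma auxT_nonneg (A v : ℝ) (u : ℕ → ℝ) (hA : 0 < A) (hv : 0 < v) (hu : ∀ n, 0 < u n) (n j : ℕ) :
    0 ≤ (auxT A v u n).coeff j := by
  induction n generalizing j with
  | zero => rw [auxT, coeff_one]; split_ifs <;> norm_num
  | succ n ih =>
    rw [auxT_coeff]
    have h1 : 0 ≤ (auxT A v u n * X).coeff j := by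
      cases j with
      | zero => simp
      | succ j => rw [coeff_mul_X]; exact ih j
    have := hu (n+1)
    have := ih j
    positivity

lemma auxT_pos (A v : ℝ) (u : ℕ → ℝ) (hA : 0 < A) (hv : 0 < v) (hu : ∀ n, 0 < u n) (n j : ℕ)
    (hj : j ≤ n) : 0 < (auxT A v u n).coeff j := by
  induction n generalizing j with
  | zero => obtain rfl : j = 0 := by omega
            simp [auxT]
  | succ n ih =>
    rw [auxT_coeff]
    have h3 := auxT_nonneg A v u hA hv hu n j
    have h4 := hu (n+1)
    cases j with
    | zero =>
      have := ih 0 (by omega)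
      simp only [coeff_mul_X_zero]
      positivity
    | succ j =>
      rw [coeff_mul_X]
      have := ih j (by omega)
      positivity

lemma auxT_natDegree (A v : ℝ) (u : ℕ → ℝ) (n : ℕ) : (auxT A v u n).natDegree ≤ n := by
  induction n with
  | zero => simp [auxT]
  | succ n ih =>
    rw [auxT]
    refine (natDegree_C_mul_le _ _).trans (natDegree_mul_le.trans ?_)
    have : (X * C (u (n+1)) + C v).natDegree ≤ 1 := by
      rw [mul_comm]; exact natDegree_linear_le
    omega

open Asymptotics in
lemma aux_asym (l : Filter ℝ) (M : ℕ) (c : ℕ → ℝ → ℝ[X]) (A v : ℝ → ℝ) (a B d u : ℕ → ℝ → ℝ)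
    (hA : ∀ᶠ q in l, 0 < A q) (hv : ∀ᶠ q in l, 0 < v q) (hu : ∀ᶠ q in l, ∀ n, 0 < u n q)
    (ha : ∀ n, 1 ≤ n → n ≤ M → a n ~[l] A) (hB : ∀ n, 1 ≤ n → n ≤ M → B n ~[l] v)
    (hd : ∀ n, 2 ≤ n → n ≤ M → d n =o[l] (fun q => v q ^ 2 / A q))
    (hc0 : ∀ q, c 0 q = 1)
    (hc1 : ∀ᶠ q in l, c 1 q * C (a 1 q) = c 0 q * (X * C (u 1 q) + C (B 1 q)))
    (hrec : ∀ᶠ q in l, ∀ n : ℕ, 2 ≤ n → c n q * C (a n q)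
      = c (n-1) q * (X * C (u n q) + C (B n q)) - c (n-2) q * C (d n q)) :
    ∀ n, n ≤ M → ∀ j, (fun q => (c n q).coeff j) ~[l]
      (fun q => (auxT (A q) (v q) (fun n => u n q) n).coeff j) := by
  have hnn : ∀ n j, ∀ᶠ q in l, 0 ≤ (auxT (A q) (v q) (fun n => u n q) n).coeff j := by
    intro n j
    filter_upwards [hA, hv, hu] with q h1 h2 h3
    exact auxT_nonneg _ _ _ h1 h2 h3 n j
  have hnnX : ∀ n j, ∀ᶠ q in l, 0 ≤ (auxT (A q) (v q) (fun n => u n q) n * X).coeff j := by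
    intro n j
    cases j with
    | zero => simp
    | succ j => simp only [coeff_mul_X]; exact hnn n j
  -- main step
  have step : ∀ n, n + 1 ≤ M → (∀ j, (fun q => (c n q).coeff j) ~[l]
      (fun q => (auxT (A q) (v q) (fun n => u n q) n).coeff j)) → ∀ j,
      (fun q => u (n+1) q * (c n q * X).coeff j + B (n+1) q * (c n q).coeff j) ~[l]
      (fun q => u (n+1) q * (auxT (A q) (v q) (fun n => u n q) n * X).coeff j
        + v q * (auxT (A q) (v q) (fun n => u n q) n).coeff j) := by
    intro n hn ih j
    apply aux_add
    · filter_upwards [hu, hnnX n j] with q h1 h2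
      have := h1 (n+1); positivity
    · filter_upwards [hv, hnn n j] with q h1 h2
      positivity
    · refine IsEquivalent.mul (IsEquivalent.refl) ?_
      cases j with
      | zero => simp only [coeff_mul_X_zero]; exact IsEquivalent.refl
      | succ j => simp only [coeff_mul_X]; exact ih j
    · exact (hB (n+1) (by omega) hn).mul (ih j)
  have hane : ∀ n, 1 ≤ n → n ≤ M → ∀ᶠ q in l, a n q ≠ 0 := by
    intro n h1 h2
    filter_upwards [(ha n h1 h2).eventually_pos hA] with q h
    exact h.ne'
  intro n
  induction n using Nat.strong_induction_on with
  | _ n ih =>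
  match n, ih with
  | 0, _ =>
    intro _ j
    simp only [hc0, auxT]
    exact IsEquivalent.refl
  | 1, ih =>
    intro hn j
    have h1 := (step 0 hn (ih 0 (by omega) (by omega)) j).div (ha 1 le_rfl hn)
    refine (h1.congr_left ?_).congr_right ?_
    · filter_upwards [hc1, hane 1 le_rfl hn] with q h2 h3
      have h4 := congrArg (fun p => p.coeff j) h2
      simp only [mul_add, ← mul_assoc, coeff_add, coeff_mul_C] at h4
      simp only [Pi.div_apply]
      rw [div_eq_iff h3, h4]; ring
    · filter_upwards with q
      rw [auxT_coeff]; rfl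
  | n + 2, ih =>
    intro hn j
    have h1 := step (n+1) hn (ih (n+1) (by omega) (by omega)) j
    have h0 : (fun q => d (n+2) q * (c n q).coeff j) =o[l] (fun q => u (n+2) q * (auxT (A q) (v q) (fun n => u n q) (n+1) * X).coeff j
        + v q * (auxT (A q) (v q) (fun n => u n q) (n+1)).coeff j) := by
      have h2 := (hd (n+2) (by omega) hn).mul_isBigO (ih n (by omega) (by omega) j).isBigO
      refine h2.trans_isBigO (IsBigO.of_bound 1 ?_)
      filter_upwards [hA, hv, hu, hnn n j, hnnX n j, hnnX (n+1) j] with q g1 g2 g3 g4 g5 g6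
      have g7 := g3 (n+2)
      have g8 := g3 (n+1)
      rw [auxT_coeff (A q) (v q) (fun n => u n q) n j]
      rw [Real.norm_eq_abs, Real.norm_eq_abs, abs_of_nonneg (by positivity),
        abs_of_nonneg (by positivity), one_mul]
      have k1 : 0 ≤ u (n+2) q * (auxT (A q) (v q) (fun n => u n q) (n+1) * X).coeff j := by positivity
      have k2 : v q ^ 2 / A q * (auxT (A q) (v q) (fun n => u n q) n).coeff j ≤
        v q * ((u (n+1) q * (auxT (A q) (v q) (fun n => u n q) n * X).coeff j
          + v q * (auxT (A q) (v q) (fun n => u n q) n).coeff j) / A q) := by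
        have : 0 ≤ v q * (u (n+1) q * (auxT (A q) (v q) (fun n => u n q) n * X).coeff j / A q) := by
          positivity
        have e : v q * ((u (n+1) q * (auxT (A q) (v q) (fun n => u n q) n * X).coeff j
          + v q * (auxT (A q) (v q) (fun n => u n q) n).coeff j) / A q) =
          v q * (u (n+1) q * (auxT (A q) (v q) (fun n => u n q) n * X).coeff j / A q) +
          v q ^ 2 / A q * (auxT (A q) (v q) (fun n => u n q) n).coeff j := by ring
        linarith
      linarith
    have h3 := (h1.sub_isLittleO h0).div (ha (n+2) (by omega) hn)
    refine (h3.congr_left ?_).congr_right ?_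
    · filter_upwards [hrec, hane (n+2) (by omega) hn] with q h2 h3
      have h4 := congrArg (fun p => p.coeff j) (h2 (n+2) (by omega))
      simp only [show n + 2 - 1 = n + 1 by omega, show n + 2 - 2 = n by omega,
        mul_add, ← mul_assoc, coeff_add, coeff_sub, coeff_mul_C] at h4
      simp only [Pi.div_apply, Pi.sub_apply]
      rw [div_eq_iff h3, h4]; ring
    · filter_upwards with q
      rw [auxT_coeff]; rfl

open Asymptotics in
lemma aux_rpow {a b : ℝ} (h : b < a) :
    (fun q : ℝ => q ^ a) =o[nhdsWithin 0 (Ioi 0)] (fun q : ℝ => q ^ b) := by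
  rw [isLittleO_iff_tendsto']
  · have h1 : Tendsto (fun q : ℝ => q ^ (a - b)) (nhdsWithin 0 (Ioi 0)) (nhds 0) := by
      have := (Real.continuousAt_rpow_const 0 (a - b) (Or.inr (by linarith))).tendsto
      rw [Real.zero_rpow (by linarith)] at this
      exact this.mono_left nhdsWithin_le_nhds
    refine h1.congr' ?_
    filter_upwards [self_mem_nhdsWithin] with q hq
    rw [Real.rpow_sub hq]
  · filter_upwards [self_mem_nhdsWithin] with q hq h0
    exact absurd h0 (Real.rpow_pos_of_pos hq b).ne'

lemma aux_rpow0 {a : ℝ} (h : 0 < a) :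
    Tendsto (fun q : ℝ => q ^ a) (nhdsWithin 0 (Ioi 0)) (nhds 0) := by
  have := aux_rpow h
  simp only [Real.rpow_zero] at this
  exact (Asymptotics.isLittleO_one_iff ℝ).1 this

open Asymptotics in
/-- signs of a polynomial whose coefficients are equivalent to those of a positive one -/
lemma aux_eval (l : Filter ℝ) (M : ℕ) (P G : ℝ → ℝ[X]) (y : ℝ → ℝ) (L : ℝ)
    (hP : ∀ᶠ q in l, (P q).natDegree ≤ M) (hG : ∀ᶠ q in l, (G q).natDegree ≤ M)
    (hnn : ∀ᶠ q in l, ∀ j, 0 ≤ (G q).coeff j)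
    (he : ∀ j, j ≤ M → (fun q => (P q).coeff j) ~[l] (fun q => (G q).coeff j))
    (hpos : ∀ᶠ q in l, 0 < (G q).eval |y q|)
    (hlim : Tendsto (fun q => (G q).eval (y q) / (G q).eval |y q|) l (nhds L)) :
    Tendsto (fun q => (P q).eval (y q) / (G q).eval |y q|) l (nhds L) := by
  have h1 : (fun q => ∑ j ∈ Finset.range (M+1), ((P q).coeff j - (G q).coeff j) * y q ^ j) =o[l]
      (fun q => (G q).eval |y q|) := by
    have h0 := IsLittleO.sum (l := l) (s := Finset.range (M+1)) (g' := fun q => (G q).eval |y q|)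
      (A := fun j q => ((P q).coeff j - (G q).coeff j) * y q ^ j) ?_
    · refine h0.congr_left ?_
      intro q; simp
    intro j hj
    have hj := Finset.mem_range.1 hj
    have h2 := (he j (by omega)).isLittleO.mul_isBigO (isBigO_refl (fun q => y q ^ j) l)
    refine h2.trans_isBigO (IsBigO.of_bound 1 ?_)
    filter_upwards [hG, hnn] with q g1 g2
    have g3 : (G q).coeff j * |y q| ^ j ≤ (G q).eval |y q| := by
      rw [eval_eq_sum_range' (Nat.lt_succ_of_le g1)]
      exact Finset.single_le_sum (f := fun i => (G q).coeff i * |y q| ^ i)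
        (fun i _ => mul_nonneg (g2 i) (by positivity)) (Finset.mem_range.2 hj)
    have g4 : 0 ≤ (G q).coeff j * |y q| ^ j := mul_nonneg (g2 j) (by positivity)
    rw [Real.norm_eq_abs, Real.norm_eq_abs, abs_mul, abs_of_nonneg (g2 j), abs_pow, one_mul,
      abs_of_nonneg (g4.trans g3)]
    exact g3
  have h2 := h1.tendsto_div_nhds_zero.add hlim
  rw [zero_add] at h2
  refine h2.congr' ?_
  filter_upwards [hP, hG] with q g1 g2
  rw [← add_div]
  congr 1
  rw [eval_eq_sum_range' (Nat.lt_succ_of_le g1), eval_eq_sum_range' (Nat.lt_succ_of_le g2),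
    ← Finset.sum_add_distrib]
  exact Finset.sum_congr rfl fun j _ => by ring

/-- product form of `auxT` -/
lemma auxT_prod (t w h1 h lam : ℝ) (ht : 0 < t) (q : ℝ) (hq : 0 < q) (n : ℕ) :
    auxT (t * q ^ h) (q ^ (1/2 + h1) * w) (fun n => q ^ ((n : ℝ) - 1 + lam)) n =
    C (t ^ (-(n : ℝ)) * q ^ ((((n:ℝ) - 1)/2 + lam - h) * n)) *
      ∏ m ∈ Finset.range n, (X + C (q ^ ((1 : ℝ)/2 - (m : ℝ) + h1 - lam) * w)) := by
  induction n with
  | zero => simp [auxT]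
  | succ n ih =>
    rw [auxT, ih, Finset.prod_range_succ]
    have e1 : (X * C (q ^ (((n+1 : ℕ) : ℝ) - 1 + lam)) + C (q ^ (1/2 + h1) * w) : ℝ[X]) =
        C (q ^ ((n:ℝ) + lam)) * (X + C (q ^ ((1 : ℝ)/2 - (n : ℝ) + h1 - lam) * w)) := by
      rw [mul_add, ← C_mul, ← mul_assoc, ← Real.rpow_add hq, mul_comm X]
      congr 4 <;> push_cast <;> ring
    have e2 : t ^ (-((n+1:ℕ) : ℝ)) * q ^ (((((n+1:ℕ):ℝ) - 1)/2 + lam - h) * ((n+1:ℕ):ℝ)) =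
        (t * q ^ h)⁻¹ * (t ^ (-(n : ℝ)) * q ^ ((((n:ℝ) - 1)/2 + lam - h) * n)) * q ^ ((n:ℝ) + lam) := by
      rw [mul_inv, ← Real.rpow_neg hq.le, ← Real.rpow_neg_one t]
      have : ∀ a b c d e : ℝ, a * b * (c * d) * e = (a * c) * (b * d * e) := by intros; ring
      rw [this, ← Real.rpow_add ht, ← Real.rpow_add hq, ← Real.rpow_add hq]
      congr 2 <;> push_cast <;> ring
    rw [e1, e2]
    generalize ∏ m ∈ Finset.range n, (X + C (q ^ ((1 : ℝ)/2 - (m : ℝ) + h1 - lam) * w)) = Z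
    generalize t ^ (-(n : ℝ)) * q ^ ((((n:ℝ) - 1)/2 + lam - h) * n) = Y
    generalize (t * q ^ h)⁻¹ = W
    generalize q ^ ((n:ℝ) + lam) = V
    simp only [C_mul]
    ring

lemma aux_fac (a : ℝ) (x : ℝ) (hx : 0 < x) :
    Tendsto (fun q : ℝ => (q ^ a - x) / (q ^ a + x)) (nhdsWithin 0 (Ioi 0))
      (nhds (if 0 < a then -1 else if a = 0 then (1 - x) / (1 + x) else 1)) := by
  split_ifs with h1 h2
  · have h := aux_rpow0 h1
    have := (h.sub_const x).div (h.add_const x) (by linarith)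
    have h4 : (0 - x) / (0 + x) = -1 := by
      rw [div_eq_iff (by linarith)]; ring
    rw [h4] at this
    exact this
  · subst h2
    simp only [Real.rpow_zero]
    exact tendsto_const_nhds
  · have h := aux_rpow0 (a := -a) (by
      rcases lt_trichotomy a 0 with h | h | h
      · linarith
      · exact absurd h h2
      · exact absurd h h1)
    have h3 := ((h.mul_const x).const_sub 1).div ((h.mul_const x).const_add 1) (by simp)
    have h4 : (1 - 0 * x) / (1 + 0 * x) = 1 := by simp
    rw [h4] at h3
    refine h3.congr' ?_
    filter_upwards [self_mem_nhdsWithin] with q hq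
    have hq' := Real.rpow_pos_of_pos hq a
    simp only [Pi.div_apply]
    rw [Real.rpow_neg (le_of_lt hq)]
    field_simp

lemma aux_unique (n : ℕ) (r f : ℕ → ℝ) (hr : ∀ i j, i < j → j < n → r i < r j)
    (hf : ∀ i j, i < j → j < n → f i < f j) (h : ∀ i, i < n → ∃ j, j < n ∧ f i = r j) :
    ∀ i, i < n → f i = r i := by
  classical
  have mr : StrictMono (fun i : Fin n => r i) := fun i j hij => hr _ _ hij j.2
  have mf : StrictMono (fun i : Fin n => f i) := fun i j hij => hf _ _ hij j.2
  let S : Finset ℝ := Finset.univ.image (fun i : Fin n => r i)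
  have hS : S.card = n := by
    rw [Finset.card_image_of_injective _ mr.injective]; simp
  have e1 := Finset.orderEmbOfFin_unique hS (f := fun i : Fin n => r i) (by intro x; simp [S]) mr
  have e2 := Finset.orderEmbOfFin_unique hS (f := fun i : Fin n => f i) (by
    intro x
    obtain ⟨j, hj, e⟩ := h x x.2
    simp only [S, Finset.mem_image, Finset.mem_univ, true_and]
    exact ⟨⟨j, hj⟩, e.symm⟩) mf
  intro i hi
  exact congrFun (e2.trans e1.symm) ⟨i, hi⟩

lemma aux_ratio (N m : ℕ) (hm : m ≤ N) (K : ℝ → ℝ) (hK : ∀ q, 0 < q → 0 < K q) (e t x : ℝ) (ht : 0 < t)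
    (hx : 0 < x) :
    Tendsto (fun q : ℝ =>
      (C (K q) * ∏ k ∈ Finset.range (N+1), (X + C (q ^ (e - (k:ℝ)) * t))).eval (-(q ^ (e - (m:ℝ)) * t * x)) /
      (C (K q) * ∏ k ∈ Finset.range (N+1), (X + C (q ^ (e - (k:ℝ)) * t))).eval |(-(q ^ (e - (m:ℝ)) * t * x))|)
      (nhdsWithin 0 (Ioi 0)) (nhds (∏ k ∈ Finset.range (N+1),
        (if 0 < (m:ℝ) - k then -1 else if (m:ℝ) - k = 0 then (1 - x) / (1 + x) else 1))) := by
  have h := tendsto_finsetProd (Finset.range (N+1)) (fun (k:ℕ) _ => aux_fac ((m:ℝ) - k) x hx)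
  refine h.congr' ?_
  filter_upwards [self_mem_nhdsWithin] with q hq
  have hq : 0 < q := hq
  have hS := Real.rpow_pos_of_pos hq (e - m)
  rw [abs_neg, abs_of_pos (by positivity)]
  simp only [eval_mul, eval_C, eval_prod, eval_add, eval_X]
  rw [mul_div_mul_left _ _ (hK q hq).ne', ← Finset.prod_div_distrib]
  refine Finset.prod_congr rfl fun k _ => ?_
  have e1 : q ^ (e - (k:ℝ)) = q ^ ((m:ℝ) - k) * q ^ (e - (m:ℝ)) := by
    rw [← Real.rpow_add hq]; congr 1; ring
  rw [e1]
  have e2 : -(q ^ (e - (m:ℝ)) * t * x) + q ^ ((m:ℝ) - k) * q ^ (e - (m:ℝ)) * t =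
    (q ^ ((m:ℝ) - k) - x) * (q ^ (e - (m:ℝ)) * t) := by ring
  have e3 : (q ^ (e - (m:ℝ)) * t * x) + q ^ ((m:ℝ) - k) * q ^ (e - (m:ℝ)) * t =
    (q ^ ((m:ℝ) - k) + x) * (q ^ (e - (m:ℝ)) * t) := by ring
  rw [e2, e3, mul_div_mul_right _ _ (by positivity)]

lemma aux_limneg (N m : ℕ) (hm : m ≤ N) (ε : ℝ) (h0 : 0 < ε) (h1 : ε < 1) :
    (∏ k ∈ Finset.range (N+1),
        (if 0 < (m:ℝ) - k then (-1:ℝ) else if (m:ℝ) - k = 0 then (1 - (1+ε)) / (1 + (1+ε)) else 1)) *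
    (∏ k ∈ Finset.range (N+1),
        (if 0 < (m:ℝ) - k then (-1:ℝ) else if (m:ℝ) - k = 0 then (1 - (1-ε)) / (1 + (1-ε)) else 1)) < 0 := by
  rw [← Finset.prod_mul_distrib, Finset.prod_eq_single m]
  · simp only [sub_self, lt_irrefl, if_false, if_true]
    apply mul_neg_of_neg_of_pos
    · apply div_neg_of_neg_of_pos <;> linarith
    · apply div_pos <;> linarith
  · intro k _ hk
    have : (m:ℝ) - k ≠ 0 := by
      rw [sub_ne_zero]; exact_mod_cast hk.symm
    split_ifs <;> norm_num
  · intro h; exact absurd (Finset.mem_range.2 (by omega)) h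

open Asymptotics in
/-- asymptotics of the roots -/
lemma aux_roots (N : ℕ) (P : ℝ → ℝ[X]) (K : ℝ → ℝ) (hK : ∀ q, 0 < q → 0 < K q) (e t : ℝ) (ht : 0 < t)
    (G : ℝ → ℝ[X])
    (hGe : ∀ q, 0 < q → G q = C (K q) * ∏ k ∈ Finset.range (N+1), (X + C (q ^ (e - (k:ℝ)) * t)))
    (hG : ∀ q, 0 < q → (G q).natDegree ≤ N + 1)
    (hnn : ∀ q, 0 < q → ∀ j, 0 ≤ (G q).coeff j)
    (hP : ∀ q ∈ Ioo (0:ℝ) 1, (P q).natDegree ≤ N + 1)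
    (he : ∀ j, (fun q => (P q).coeff j) ~[nhdsWithin 0 (Ioi 0)] (fun q => (G q).coeff j))
    (r : ℝ → ℕ → ℝ) (hr : ∀ q ∈ Ioo (0:ℝ) 1, ∀ i j, i < j → j < N + 1 → r q i < r q j)
    (hr0 : ∀ q ∈ Ioo (0:ℝ) 1, ∀ x, (P q).eval x = 0 → ∃ i, i < N + 1 ∧ x = r q i)
    (i : ℕ) (hi : i < N + 1) :
    Tendsto (fun q : ℝ => r q i / (-(q ^ (e - ((N - i : ℕ) : ℝ)) * t)))
      (nhdsWithin 0 (Ioi 0)) (nhds 1) := by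
  have hq0 : ∀ᶠ q in nhdsWithin (0:ℝ) (Ioi 0), q ∈ Ioo (0:ℝ) 1 := Ioo_mem_nhdsGT one_pos
  have hT : ∀ m, m ≤ N → ∀ x, 0 < x → Tendsto (fun q => (P q).eval (-(q ^ (e - (m:ℝ)) * t * x)) /
      (G q).eval |(-(q ^ (e - (m:ℝ)) * t * x))|) (nhdsWithin 0 (Ioi 0)) (nhds (∏ k ∈ Finset.range (N+1),
        (if 0 < (m:ℝ) - k then -1 else if (m:ℝ) - k = 0 then (1 - x) / (1 + x) else 1))) ∧
      ∀ᶠ q in nhdsWithin (0:ℝ) (Ioi 0), 0 < (G q).eval |(-(q ^ (e - (m:ℝ)) * t * x))| := by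
    intro m hm x hx
    have hpos : ∀ᶠ q in nhdsWithin (0:ℝ) (Ioi 0), 0 < (G q).eval |(-(q ^ (e - (m:ℝ)) * t * x))| := by
      filter_upwards [self_mem_nhdsWithin] with q hq
      have hq : 0 < q := hq
      rw [hGe q hq]
      simp only [eval_mul, eval_C, eval_prod, eval_add, eval_X]
      refine mul_pos (hK q hq) (Finset.prod_pos fun k _ => ?_)
      have := Real.rpow_pos_of_pos hq (e - k)
      positivity
    refine ⟨?_, hpos⟩
    apply aux_eval _ (N+1) P G _ _ _ _ _ (fun j _ => he j) hpos
    · refine (aux_ratio N m hm K hK e t x ht hx).congr' ?_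
      filter_upwards [self_mem_nhdsWithin] with q hq
      rw [hGe q hq]
    · filter_upwards [hq0] with q hq using hP q hq
    · filter_upwards [hq0] with q hq using hG q hq.1
    · filter_upwards [hq0] with q hq using hnn q hq.1
  have hsign : ∀ ε : ℝ, 0 < ε → ε < 1 → ∀ᶠ q in nhdsWithin (0:ℝ) (Ioi 0), ∀ m ∈ Finset.range (N+1),
      (P q).eval (-(q ^ (e - (m:ℝ)) * t * (1+ε))) * (P q).eval (-(q ^ (e - (m:ℝ)) * t * (1-ε))) < 0 := by
    intro ε h0 h1
    rw [Filter.eventually_all_finset]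
    intro m hm
    have hm : m ≤ N := by have := Finset.mem_range.1 hm; omega
    obtain ⟨a1, a2⟩ := hT m hm (1+ε) (by linarith)
    obtain ⟨b1, b2⟩ := hT m hm (1-ε) (by linarith)
    have := (a1.mul b1).eventually_lt_const (aux_limneg N m hm ε h0 h1)
    filter_upwards [this, a2, b2] with q g1 g2 g3
    rw [div_mul_div_comm, div_lt_iff₀ (mul_pos g2 g3), zero_mul] at g1
    exact g1
  rw [Metric.tendsto_nhds]
  intro ε' hε'
  obtain ⟨ε, h0, h1, h2⟩ : ∃ ε : ℝ, 0 < ε ∧ ε < 1 ∧ ε < ε' :=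
    ⟨min ε' 1 / 2, by positivity, by have := min_le_right ε' 1; linarith,
      by have := min_le_left ε' 1; linarith⟩
  have hsmall : ∀ᶠ q in nhdsWithin (0:ℝ) (Ioi 0), q ∈ Ioo (0:ℝ) ((1-ε)/(1+ε)) :=
    Ioo_mem_nhdsGT (by apply div_pos <;> linarith)
  filter_upwards [hq0, hsmall, hsign ε h0 h1] with q hq hqs hqsign
  have hSpos : ∀ m : ℕ, 0 < q ^ (e - (m:ℝ)) * t := fun m =>
    mul_pos (Real.rpow_pos_of_pos hq.1 _) ht
  have hz : ∀ j : ℕ, ∃ x, j < N + 1 → -(q ^ (e - ((N - j : ℕ):ℝ)) * t * (1+ε)) < x ∧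
      x < -(q ^ (e - ((N - j : ℕ):ℝ)) * t * (1-ε)) ∧ (P q).eval x = 0 := by
    intro j
    have := hSpos (N - j)
    obtain ⟨x, hx⟩ := aux_ivt (P q) _ _ (by nlinarith) (hqsign (N - j) (Finset.mem_range.2 (by omega)))
    exact ⟨x, fun _ => hx⟩
  choose f hf using hz
  have hfr := aux_unique (N+1) (r q) f (hr q hq) (by
    intro a b hab hb
    have ha1 := (hf a (by omega)).2.1
    have hb1 := (hf b hb).1
    refine ha1.trans (lt_of_le_of_lt ?_ hb1)
    have hs : q ^ (e - ((N - b : ℕ):ℝ)) ≤ q * q ^ (e - ((N - a : ℕ):ℝ)) := by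
      nth_rewrite 2 [← Real.rpow_one q]
      rw [← Real.rpow_add hq.1]
      apply Real.rpow_le_rpow_of_exponent_ge hq.1 hq.2.le
      have : N - b + 1 ≤ N - a := by omega
      have : ((N - b : ℕ):ℝ) + 1 ≤ ((N - a : ℕ):ℝ) := by exact_mod_cast this
      linarith
    have hq3 := hqs.2
    rw [lt_div_iff₀ (by linarith)] at hq3
    have hSa := hSpos (N - a)
    have k1 : q ^ (e - ((N - b : ℕ):ℝ)) * (t * (1 + ε)) ≤ q * q ^ (e - ((N - a : ℕ):ℝ)) * (t * (1 + ε)) :=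
      mul_le_mul_of_nonneg_right hs (by positivity)
    have k2 : q ^ (e - ((N - a : ℕ):ℝ)) * t * (q * (1+ε)) ≤ q ^ (e - ((N - a : ℕ):ℝ)) * t * (1 - ε) :=
      mul_le_mul_of_nonneg_left hq3.le hSa.le
    linarith) (fun a ha => hr0 q hq _ (hf a ha).2.2)
  rw [← hfr i hi]
  obtain ⟨g1, g2, _⟩ := hf i hi
  have hS := hSpos (N - i)
  rw [Real.dist_eq, abs_lt]
  have e1 : f i / (-(q ^ (e - ((N - i : ℕ):ℝ)) * t)) = (-f i) / (q ^ (e - ((N - i : ℕ):ℝ)) * t) := by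
    rw [div_neg, neg_div]
  rw [e1]
  have k1 : (-f i) / (q ^ (e - ((N - i : ℕ):ℝ)) * t) < 1 + ε := by
    rw [div_lt_iff₀ hS]; linarith
  have k2 : 1 - ε < (-f i) / (q ^ (e - ((N - i : ℕ):ℝ)) * t) := by
    rw [lt_div_iff₀ hS]; linarith
  constructor <;> linarith


/-- ultradiscrete limit of the q-Heun spectral polynomial:
coefficient-wise `c_{N+1}(E) ~ (t₁t₂)^{-N-1} q^{(N/2+λ₁-h₁-h₂)(N+1)} ∏_{m=0}^{N}
(E + q^{1/2-m+h₁-λ₁} t₁)` as `q → +0`, and the ordered roots satisfy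
`E_k(q) ~ -q^{k-N-1/2+h₁-λ₁} t₁`. -/
theorem stmt15 (h₁ h₂ l₁ l₂ α₁ α₂ β t₁ t₂ lam : ℝ)
    (hlam : lam = (h₁ + h₂ - l₁ - l₂ - α₁ - α₂ - β + 2) / 2)
    (N : ℕ) (hN : (N : ℝ) = -lam - α₁)
    (hβ : β < 1) (hα : α₂ - α₁ < 1) (ht₁ : 0 < t₁) (ht₂ : 0 < t₂)
    (hh : h₁ < h₂) (hl : l₁ < l₂)
    (hyp1 : 0 < 1 + h₂ - l₂ - β) (hyp2 : 0 < 2 + 2 * h₂ - l₁ - l₂ - β)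
    (c : ℕ → ℝ → Polynomial ℝ) (hc0 : ∀ q, c 0 q = 1)
    (hc1 : ∀ q ∈ Ioo (0 : ℝ) 1,
      c 1 q * C (t₁ * t₂ * q ^ (h₁ + h₂) * (1 - q ^ (1 : ℝ)) * (1 - q ^ ((1 : ℝ) - β)))
      = c 0 q * (X * C (q ^ ((1 : ℝ) - 1 + lam))
          + C (q ^ ((1 : ℝ)/2) * (q ^ h₁ * t₁ + q ^ h₂ * t₂)
              + (q ^ l₁ * t₁ + q ^ l₂ * t₂) * q ^ (2 * ((1 : ℝ) + lam) + α₁ + α₂ - 5/2))))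
    (hrec : ∀ q ∈ Ioo (0 : ℝ) 1, ∀ n : ℕ, 2 ≤ n →
      c n q * C (t₁ * t₂ * q ^ (h₁ + h₂) * (1 - q ^ (n : ℝ)) * (1 - q ^ ((n : ℝ) - β)))
      = c (n - 1) q * (X * C (q ^ ((n : ℝ) - 1 + lam))
          + C (q ^ ((1 : ℝ)/2) * (q ^ h₁ * t₁ + q ^ h₂ * t₂)
              + (q ^ l₁ * t₁ + q ^ l₂ * t₂) * q ^ (2 * ((n : ℝ) + lam) + α₁ + α₂ - 5/2)))
        - c (n - 2) q
            * C (q * (1 - q ^ ((n : ℝ) - 2 + lam + α₁)) * (1 - q ^ ((n : ℝ) - 2 + lam + α₂)))) :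
    (∀ j : ℕ, j ≤ N + 1 →
      Tendsto (fun q : ℝ => (c (N + 1) q).coeff j /
          (C ((t₁ * t₂) ^ (-(N : ℝ) - 1) * q ^ (((N : ℝ)/2 + lam - h₁ - h₂) * ((N : ℝ) + 1)))
            * ∏ m ∈ Finset.range (N + 1),
                (X + C (q ^ ((1 : ℝ)/2 - (m : ℝ) + h₁ - lam) * t₁))).coeff j)
        (nhdsWithin 0 (Ioi 0)) (nhds 1))
    ∧ ∃ Er : ℕ → ℝ → ℝ,
      (∀ q ∈ Ioo (0 : ℝ) 1,
        (∀ k, 1 ≤ k → k ≤ N + 1 → (c (N + 1) q).eval (Er k q) = 0)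
        ∧ (∀ k l, 1 ≤ k → k < l → l ≤ N + 1 → Er k q < Er l q)
        ∧ (∀ x : ℝ, (c (N + 1) q).eval x = 0 → ∃ k, 1 ≤ k ∧ k ≤ N + 1 ∧ x = Er k q))
      ∧ ∀ k, 1 ≤ k → k ≤ N + 1 →
          Tendsto (fun q : ℝ => Er k q / (-(q ^ ((k : ℝ) - (N : ℝ) - 1/2 + h₁ - lam) * t₁)))
            (nhdsWithin 0 (Ioi 0)) (nhds 1) := by
  classical
  have hq0 : ∀ᶠ q in nhdsWithin (0:ℝ) (Ioi 0), q ∈ Ioo (0:ℝ) 1 := Ioo_mem_nhdsGT one_pos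
  let A : ℝ → ℝ := fun q => t₁ * t₂ * q ^ (h₁ + h₂)
  let v : ℝ → ℝ := fun q => q ^ (1/2 + h₁) * t₁
  let u : ℕ → ℝ → ℝ := fun n q => q ^ ((n : ℝ) - 1 + lam)
  let a : ℕ → ℝ → ℝ := fun n q =>
    t₁ * t₂ * q ^ (h₁ + h₂) * (1 - q ^ (n : ℝ)) * (1 - q ^ ((n : ℝ) - β))
  let B : ℕ → ℝ → ℝ := fun n q => q ^ ((1 : ℝ)/2) * (q ^ h₁ * t₁ + q ^ h₂ * t₂)
              + (q ^ l₁ * t₁ + q ^ l₂ * t₂) * q ^ (2 * ((n : ℝ) + lam) + α₁ + α₂ - 5/2)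
  let d : ℕ → ℝ → ℝ := fun n q =>
    q * (1 - q ^ ((n : ℝ) - 2 + lam + α₁)) * (1 - q ^ ((n : ℝ) - 2 + lam + α₂))
  have hc1' : ∀ q ∈ Ioo (0:ℝ) 1, c 1 q * C (a 1 q) = c 0 q * (X * C (u 1 q) + C (B 1 q)) := by
    intro q hq
    simp only [a, u, B, Nat.cast_one]
    exact hc1 q hq
  have hApos : ∀ q, 0 < q → 0 < A q := fun q hq => by
    have := Real.rpow_pos_of_pos hq (h₁ + h₂); simp only [A]; positivity
  have hvpos : ∀ q, 0 < q → 0 < v q := fun q hq => by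
    have := Real.rpow_pos_of_pos hq (1/2 + h₁); simp only [v]; positivity
  have hupos : ∀ q, 0 < q → ∀ n, 0 < u n q := fun q hq n => Real.rpow_pos_of_pos hq _
  have hex : ∀ n : ℕ, n ≤ N + 1 → (n : ℝ) - 2 + lam + α₁ < 0 ∧ (n : ℝ) - 2 + lam + α₂ < 0 := by
    intro n hn
    have : (n : ℝ) ≤ N + 1 := by exact_mod_cast hn
    constructor <;> linarith
  -- interlacing
  have hint : ∀ q ∈ Ioo (0:ℝ) 1, (c (N+1) q).natDegree = N + 1 ∧
      0 < (c (N+1) q).leadingCoeff ∧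
      ∃ r : ℕ → ℝ, (∀ i j, i < j → j < N + 1 → r i < r j) ∧
        (∀ i, i < N + 1 → (c (N+1) q).eval (r i) = 0) := by
    intro q hq
    obtain ⟨_, h1, h2, r, h3, h4, _⟩ := aux_interlace (N+1) (fun n => c n q) (fun n => a n q)
      (fun n => u n q) (fun n => B n q) (fun n => d n q) (hc0 q)
      (by
        intro n h1 _
        have h1' : (1:ℝ) ≤ n := by exact_mod_cast h1
        have k1 : q ^ (n:ℝ) < 1 := Real.rpow_lt_one hq.1.le hq.2 (by linarith)
        have k2 : q ^ ((n:ℝ) - β) < 1 := Real.rpow_lt_one hq.1.le hq.2 (by linarith)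
        exact mul_pos (mul_pos (hApos q hq.1) (by linarith)) (by linarith))
      (fun n _ _ => hupos q hq.1 n)
      (by
        intro n _ h2
        obtain ⟨e1, e2⟩ := hex n h2
        have k1 := Real.one_lt_rpow_of_pos_of_lt_one_of_neg hq.1 hq.2 e1
        have k2 := Real.one_lt_rpow_of_pos_of_lt_one_of_neg hq.1 hq.2 e2
        exact mul_pos_of_neg_of_neg (mul_neg_of_pos_of_neg hq.1 (by linarith)) (by linarith))
      (hc1' q hq) (hrec q hq) N le_rfl
    exact ⟨h1, h2, r, h3, h4⟩
  have hallr : ∀ q ∈ Ioo (0:ℝ) 1, ∀ r : ℕ → ℝ, (∀ i j, i < j → j < N + 1 → r i < r j) →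
      (∀ i, i < N + 1 → (c (N+1) q).eval (r i) = 0) →
      ∀ x, (c (N+1) q).eval x = 0 → ∃ i, i < N + 1 ∧ x = r i := by
    intro q hq r h3 h4 x hx
    obtain ⟨h1, h2, _⟩ := hint q hq
    rw [aux_factor (N+1) _ h1 h2 r h3 h4, eval_mul, eval_C, eval_prod] at hx
    have := (mul_eq_zero.1 hx).resolve_left h2.ne'
    obtain ⟨i, hi, e⟩ := Finset.prod_eq_zero_iff.1 this
    simp only [eval_sub, eval_X, eval_C] at e
    exact ⟨i, Finset.mem_range.1 hi, by linarith⟩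
  -- asymptotics
  have hasym := aux_asym (nhdsWithin 0 (Ioi 0)) (N+1) c A v a B d u
    (by filter_upwards [hq0] with q hq using hApos q hq.1)
    (by filter_upwards [hq0] with q hq using hvpos q hq.1)
    (by filter_upwards [hq0] with q hq using hupos q hq.1)
    (by
      intro n hn _
      have hn' : (1:ℝ) ≤ n := by exact_mod_cast hn
      apply Asymptotics.isEquivalent_of_tendsto_one
      have k1 := (aux_rpow0 (a := (n:ℝ)) (by linarith)).const_sub 1
      have k2 := (aux_rpow0 (a := (n:ℝ) - β) (by linarith)).const_sub 1
      have k3 := k1.mul k2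
      rw [sub_zero, mul_one] at k3
      refine k3.congr' ?_
      filter_upwards [hq0] with q hq
      have := (hApos q hq.1).ne'
      rw [Pi.div_apply, eq_div_iff this]
      simp only [a, A]; ring)
    (by
      intro n hn _
      have hn' : (1:ℝ) ≤ n := by exact_mod_cast hn
      have k1 := (aux_rpow (a := 1/2 + h₂) (b := 1/2 + h₁) (by linarith)).const_mul_left t₂
      have k2 := (aux_rpow (a := l₁ + (2 * ((n : ℝ) + lam) + α₁ + α₂ - 5/2)) (b := 1/2 + h₁)
        (by linarith)).const_mul_left t₁
      have k3 := (aux_rpow (a := l₂ + (2 * ((n : ℝ) + lam) + α₁ + α₂ - 5/2)) (b := 1/2 + h₁)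
        (by linarith)).const_mul_left t₂
      have k4 := ((k1.add k2).add k3).trans_isBigO
        ((Asymptotics.isBigO_refl (fun q : ℝ => q ^ (1/2 + h₁)) (nhdsWithin 0 (Ioi 0))).const_mul_right
          ht₁.ne')
      refine k4.congr' ?_ ?_
      · filter_upwards [hq0] with q hq
        simp only [Pi.sub_apply, B, v]
        rw [Real.rpow_add hq.1, Real.rpow_add hq.1, Real.rpow_add hq.1, Real.rpow_add hq.1]
        ring
      · filter_upwards with q
        simp only [v]; ring)
    (by
      intro n hn hnN
      have hn' : (2:ℝ) ≤ n := by exact_mod_cast hn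
      obtain ⟨e1, e2⟩ := hex n hnN
      have k1 : d n =O[nhdsWithin 0 (Ioi 0)]
          (fun q : ℝ => q ^ (1 + ((n : ℝ) - 2 + lam + α₁) + ((n : ℝ) - 2 + lam + α₂))) := by
        apply Asymptotics.IsBigO.of_bound 1
        filter_upwards [hq0] with q hq
        have k1 := Real.one_lt_rpow_of_pos_of_lt_one_of_neg hq.1 hq.2 e1
        have k2 := Real.one_lt_rpow_of_pos_of_lt_one_of_neg hq.1 hq.2 e2
        have hq1 := hq.1
        rw [Real.rpow_add hq.1, Real.rpow_add hq.1, Real.rpow_one, one_mul]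
        simp only [d, norm_mul, Real.norm_eq_abs]
        refine mul_le_mul (mul_le_mul le_rfl ?_ (abs_nonneg _) (abs_nonneg _)) ?_ (abs_nonneg _)
          (by positivity)
        · rw [abs_of_neg (by linarith), abs_of_pos (by linarith)]; linarith
        · rw [abs_of_neg (by linarith), abs_of_pos (by linarith)]; linarith
      have k2 := k1.trans_isLittleO (aux_rpow (b := 1 + h₁ - h₂) (by linarith))
      have k3 := k2.trans_isBigO
        ((Asymptotics.isBigO_refl (fun q : ℝ => q ^ (1 + h₁ - h₂)) (nhdsWithin 0 (Ioi 0))).const_mul_right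
          (div_pos ht₁ ht₂).ne')
      refine k3.congr' EventuallyEq.rfl ?_
      filter_upwards [hq0] with q hq
      have hp := Real.rpow_pos_of_pos hq.1 (h₁ + h₂)
      have e3 : q ^ (1/2 + h₁) * q ^ (1/2 + h₁) = q ^ (1 + h₁ - h₂) * q ^ (h₁ + h₂) := by
        rw [← Real.rpow_add hq.1, ← Real.rpow_add hq.1]; congr 1; ring
      simp only [v, A]
      rw [eq_div_iff (by positivity), mul_pow, pow_two, e3]
      field_simp)
    hc0
    (by filter_upwards [hq0] with q hq using hc1' q hq)
    (by filter_upwards [hq0] with q hq using hrec q hq)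
    (N+1) le_rfl
  -- identification of the target
  have hG : ∀ q, 0 < q → auxT (A q) (v q) (fun n => u n q) (N+1) =
      C ((t₁ * t₂) ^ (-(N : ℝ) - 1) * q ^ (((N : ℝ)/2 + lam - h₁ - h₂) * ((N : ℝ) + 1)))
            * ∏ m ∈ Finset.range (N + 1),
                (X + C (q ^ ((1 : ℝ)/2 - (m : ℝ) + h₁ - lam) * t₁)) := by
    intro q hq
    have := auxT_prod (t₁ * t₂) t₁ h₁ (h₁ + h₂) lam (by positivity) q hq (N+1)
    simp only [A, v, u]
    rw [this]
    congr 4 <;> push_cast <;> ring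
  have hr : ∀ q : ℝ, ∃ r : ℕ → ℝ, q ∈ Ioo (0:ℝ) 1 → (∀ i j, i < j → j < N + 1 → r i < r j) ∧
        (∀ i, i < N + 1 → (c (N+1) q).eval (r i) = 0) := by
    intro q
    by_cases hq : q ∈ Ioo (0:ℝ) 1
    · obtain ⟨_, _, r, h⟩ := hint q hq
      exact ⟨r, fun _ => h⟩
    · exact ⟨0, fun h => absurd h hq⟩
  choose r hr using hr
  refine ⟨?_, fun k q => r q (k - 1), ?_, ?_⟩
  · intro j hj
    have h1 := (Asymptotics.isEquivalent_iff_tendsto_one (by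
      filter_upwards [hq0] with q hq
      exact (auxT_pos _ _ _ (hApos q hq.1) (hvpos q hq.1) (hupos q hq.1) (N+1) j hj).ne')).1 (hasym j)
    refine h1.congr' ?_
    filter_upwards [hq0] with q hq
    rw [Pi.div_apply, hG q hq.1]
  · intro q hq
    obtain ⟨h3, h4⟩ := hr q hq
    refine ⟨fun k hk1 hk2 => h4 _ (by omega), fun k l hk1 hkl hl => h3 _ _ (by omega) (by omega), ?_⟩
    intro x hx
    obtain ⟨i, hi, e⟩ := hallr q hq (r q) h3 h4 x hx
    exact ⟨i + 1, by omega, by omega, e⟩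
  · intro k hk1 hk2
    have h1 := aux_roots N (fun q => c (N+1) q)
      (fun q => (t₁ * t₂) ^ (-(N : ℝ) - 1) * q ^ (((N : ℝ)/2 + lam - h₁ - h₂) * ((N : ℝ) + 1)))
      (by
        intro q hq
        have := Real.rpow_pos_of_pos hq (((N : ℝ)/2 + lam - h₁ - h₂) * ((N : ℝ) + 1))
        positivity)
      (1/2 + h₁ - lam) t₁ ht₁
      (fun q => auxT (A q) (v q) (fun n => u n q) (N+1))
      (by
        intro q hq
        rw [hG q hq]
        congr 1
        refine Finset.prod_congr rfl fun m _ => ?_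
        congr 4; ring)
      (fun q _ => auxT_natDegree _ _ _ _)
      (fun q hq j => auxT_nonneg _ _ _ (hApos q hq) (hvpos q hq) (hupos q hq) _ j)
      (fun q hq => (hint q hq).1.le)
      hasym r (fun q hq => (hr q hq).1)
      (fun q hq => hallr q hq (r q) (hr q hq).1 (hr q hq).2)
      (k - 1) (by omega)
    have e : (1/2 + h₁ - lam - ((N - (k - 1) : ℕ) : ℝ)) = (k : ℝ) - (N : ℝ) - 1/2 + h₁ - lam := by
      rw [Nat.cast_sub (by omega), Nat.cast_sub hk1]; push_cast; ring
    rw [e] at h1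
    exact h1
end

section
/- Let k ∈ {1,…,N+1}. Under the assumptions 0 < q < 1, N = -λ₁-α₁ ∈ ℤ_{≥0}, β < 1, α₂-α₁ < 1, t₁ > 0, t₂ > 0, h₁ < h₂, l₁ < l₂, 1+h₂-l₂-β > 0, 2+2h₂-l₁-l₂-β > 0, let E_{N+2-k}(q) be the root of the spectral polynomial c_{N+1}(E) = 0 with E_{N+2-k}(q) ~ -q^{3/2-k+h₁-λ₁}t₁. Then for sufficiently small q the Heun polynomial Σ_{n=0}^{N} cₙ(E_{N+2-k}(q)) xⁿ has N zeros x_1(q), …, x_N(q), continuous in q, satisfying lim_{q→+0} x_j(q)/(q^{j-1/2+h₂} t₂) = 1 for j = 1,…,k-1 and lim_{q→+0} x_j(q)/(-q^{-2j-1/2-h₂+l₁+l₂+β} t₁) = 1 for j = k,…,N. -/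
open Polynomial Filter Set

def As (f : ℝ → ℝ) (a C : ℝ) : Prop :=
  Tendsto (fun q : ℝ => f q * q ^ (-a)) (nhdsWithin 0 (Ioi 0)) (nhds C)

lemma ev_pos : ∀ᶠ q : ℝ in nhdsWithin 0 (Ioi 0), 0 < q := self_mem_nhdsWithin

lemma ev_Ioo {r : ℝ} (hr : 0 < r) : ∀ᶠ q : ℝ in nhdsWithin 0 (Ioi 0), q ∈ Ioo 0 r :=
  Ioo_mem_nhdsGT hr

lemma As.congr {f g : ℝ → ℝ} {a C : ℝ} (h : As f a C)
    (hfg : ∀ᶠ q in nhdsWithin 0 (Ioi 0), f q = g q) : As g a C := by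
  refine Tendsto.congr' ?_ h
  filter_upwards [hfg] with q hq
  rw [hq]

lemma As.cast {f : ℝ → ℝ} {a C a' C' : ℝ} (h : As f a C) (ha : a = a') (hC : C = C') :
    As f a' C' := by subst ha hC; exact h

lemma As.mul {f g : ℝ → ℝ} {a b C D : ℝ} (hf : As f a C) (hg : As g b D) :
    As (fun q => f q * g q) (a + b) (C * D) := by
  refine Tendsto.congr' ?_ (Tendsto.mul hf hg)
  filter_upwards [ev_pos] with q hq
  rw [neg_add, Real.rpow_add hq]; ring

lemma As.inv {f : ℝ → ℝ} {a C : ℝ} (hf : As f a C) (hC : C ≠ 0) :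
    As (fun q => (f q)⁻¹) (-a) C⁻¹ := by
  refine Tendsto.congr' ?_ (Tendsto.inv₀ hf hC)
  filter_upwards [ev_pos] with q hq
  rw [mul_inv, Real.rpow_neg hq.le, inv_inv, neg_neg]

lemma As.add {f g : ℝ → ℝ} {a C D : ℝ} (hf : As f a C) (hg : As g a D) :
    As (fun q => f q + g q) a (C + D) := by
  refine Tendsto.congr' ?_ (Tendsto.add hf hg)
  filter_upwards with q
  ring

lemma As.sub {f g : ℝ → ℝ} {a C D : ℝ} (hf : As f a C) (hg : As g a D) :
    As (fun q => f q - g q) a (C - D) := by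
  refine Tendsto.congr' ?_ (Tendsto.sub hf hg)
  filter_upwards with q
  ring

lemma As.rpow (a : ℝ) : As (fun q => q ^ a) a 1 := by
  refine Tendsto.congr' ?_ tendsto_const_nhds
  filter_upwards [ev_pos] with q hq
  rw [← Real.rpow_add hq]; simp

lemma As.const (c : ℝ) : As (fun _ => c) 0 c := by
  unfold As; simp

lemma rpow_tendsto_zero {p : ℝ} (hp : 0 < p) :
    Tendsto (fun q : ℝ => q ^ p) (nhdsWithin 0 (Ioi 0)) (nhds 0) := by
  have h := (Real.continuousAt_rpow_const 0 p (Or.inr hp.le)).tendsto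
  rw [Real.zero_rpow hp.ne'] at h
  exact h.mono_left nhdsWithin_le_nhds

lemma As.weaken {f : ℝ → ℝ} {a b C : ℝ} (hf : As f a C) (hb : b < a) : As f b 0 := by
  have h := Tendsto.mul hf (rpow_tendsto_zero (sub_pos.2 hb))
  rw [mul_zero] at h
  refine Tendsto.congr' ?_ h
  filter_upwards [ev_pos] with q hq
  rw [mul_assoc, ← Real.rpow_add hq]; congr 2; ring

lemma As.pow {f : ℝ → ℝ} {a C : ℝ} (hf : As f a C) (n : ℕ) :
    As (fun q => f q ^ n) (n * a) (C ^ n) := by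
  induction n with
  | zero => simpa using As.const 1
  | succ m ih =>
    refine ((ih.mul hf).congr ?_).cast ?_ ?_
    · filter_upwards with q
      rw [pow_succ]
    · push_cast; ring
    · rw [pow_succ]

lemma As.sum {s : Finset ℕ} {f : ℕ → ℝ → ℝ} {a : ℝ} {C : ℕ → ℝ}
    (h : ∀ i ∈ s, As (f i) a (C i)) : As (fun q => ∑ i ∈ s, f i q) a (∑ i ∈ s, C i) := by
  refine Tendsto.congr' ?_ (tendsto_finsetSum s h)
  filter_upwards with q
  rw [Finset.sum_mul]

lemma As.ev_neg {f : ℝ → ℝ} {a C : ℝ} (hf : As f a C) (hC : C < 0) :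
    ∀ᶠ q in nhdsWithin 0 (Ioi 0), f q < 0 := by
  filter_upwards [ev_pos, Tendsto.eventually_lt_const hC hf] with q hq h
  have := Real.rpow_pos_of_pos hq (-a)
  exact neg_of_mul_neg_left h this.le

lemma As.ev_ne {f : ℝ → ℝ} {a C : ℝ} (hf : As f a C) (hC : C ≠ 0) :
    ∀ᶠ q in nhdsWithin 0 (Ioi 0), f q ≠ 0 := by
  filter_upwards [Tendsto.eventually_ne hf hC] with q h h0
  exact h (by rw [h0, zero_mul])

lemma As.one_sub_pos {a : ℝ} (ha : 0 < a) : As (fun q => 1 - q ^ a) 0 1 := by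
  simpa using (As.const 1).sub ((As.rpow a).weaken ha)

lemma As.one_sub_neg {a : ℝ} (ha : a < 0) : As (fun q => 1 - q ^ a) a (-1) := by
  simpa using ((As.const 1).weaken ha).sub (As.rpow a)

lemma fwd (u A B D : ℕ → ℝ → ℝ) (a K : ℝ) (b d bb : ℕ → ℝ) (M : ℕ) (hK : K ≠ 0)
    (hA : ∀ n, 1 ≤ n → As (A n) a K)
    (hB : ∀ n, 1 ≤ n → n ≤ M → As (B n) (b n) (bb n))
    (hD : ∀ n, n + 2 ≤ M → As (D (n+2)) (d (n+2)) 1)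
    (hcond : ∀ n, n + 2 ≤ M → b (n+1) + b (n+2) - a < d (n+2))
    (u0 : ∀ q, u 0 q = 1)
    (u1 : ∀ᶠ q in nhdsWithin 0 (Ioi 0), u 1 q * A 1 q = B 1 q)
    (hrec : ∀ n, ∀ᶠ q in nhdsWithin 0 (Ioi 0),
      u (n+2) q * A (n+2) q = u (n+1) q * B (n+2) q - u n q * D (n+2) q) :
    ∀ n, n ≤ M → As (u n) (∑ i ∈ Finset.range n, (b (i+1) - a))
      (∏ i ∈ Finset.range n, bb (i+1) / K) := by
  intro n
  induction n using Nat.strong_induction_on with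
  | _ n ih =>
    intro hn
    match n, ih, hn with
    | 0, _, _ =>
      refine ((As.const 1).congr ?_).cast (by simp) (by simp)
      filter_upwards with q
      rw [u0]
    | 1, _, hn =>
      refine (((hB 1 le_rfl hn).mul ((hA 1 le_rfl).inv hK)).congr ?_).cast ?_ ?_
      · filter_upwards [u1, (hA 1 le_rfl).ev_ne hK] with q h1 h2
        rw [← h1, mul_assoc, mul_inv_cancel₀ h2, mul_one]
      · simp; ring
      · simp; rfl
    | m+2, ih, hn =>
      have i1 := ih (m+1) (by omega) (by omega)
      have i0 := ih m (by omega) (by omega)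
      have hc := hcond m hn
      have p1 := i1.mul (hB (m+2) (by omega) hn)
      have p2 := i0.mul (hD m hn)
      have p3 := p2.weaken (b := ∑ i ∈ Finset.range (m+1), (b (i+1) - a) + b (m+2)) (by
        rw [Finset.sum_range_succ]; linarith)
      refine (((p1.sub p3).mul ((hA (m+2) (by omega)).inv hK)).congr ?_).cast ?_ ?_
      · filter_upwards [hrec m, (hA (m+2) (by omega)).ev_ne hK] with q h1 h2
        rw [← h1, mul_assoc, mul_inv_cancel₀ h2, mul_one]
      · rw [Finset.sum_range_succ _ (m+1)]; ring
      · rw [Finset.prod_range_succ _ (m+1)]; rw [sub_zero, div_eq_mul_inv]; ring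

lemma bwd (u A B D : ℕ → ℝ → ℝ) (a K : ℝ) (b d bb : ℕ → ℝ) (N k : ℕ)
    (hA : ∀ n, 1 ≤ n → As (A n) a K)
    (hB : ∀ n, 1 ≤ n → n ≤ N + 1 → As (B n) (b n) (bb n))
    (hbb : ∀ n, k < n → bb n ≠ 0)
    (hD : ∀ n, n + 2 ≤ N + 1 → As (D (n+2)) (d (n+2)) 1)
    (hcond : ∀ n, n + 2 ≤ N + 1 → b (n+1) + b (n+2) - a < d (n+2))
    (hrec : ∀ n, ∀ᶠ q in nhdsWithin 0 (Ioi 0),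
      u (n+2) q * A (n+2) q = u (n+1) q * B (n+2) q - u n q * D (n+2) q)
    (hlast : ∀ᶠ q in nhdsWithin 0 (Ioi 0), u (N+1) q = 0) :
    ∀ r m, r + m + 1 = N → k ≤ m + 1 → ∃ w : ℝ → ℝ, As w (b (m+2) - d (m+2)) (bb (m+2)) ∧
      ∀ᶠ q in nhdsWithin 0 (Ioi 0), u m q = w q * u (m+1) q := by
  intro r
  induction r with
  | zero =>
    intro m hm hk
    have hD' := hD m (by omega)
    refine ⟨fun q => B (m+2) q * (D (m+2) q)⁻¹, ?_, ?_⟩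
    · exact ((hB (m+2) (by omega) (by omega)).mul (hD'.inv one_ne_zero)).cast (by ring) (by simp)
    · filter_upwards [hrec m, hD'.ev_ne one_ne_zero, hlast] with q h1 h2 h3
      rw [show N + 1 = m + 2 by omega] at h3
      rw [h3] at h1
      field_simp
      linarith
  | succ r ih =>
    intro m hm hk
    obtain ⟨w, hw, hw'⟩ := ih (m+1) (by omega) (by omega)
    have hD' := hD m (by omega)
    have hb3 := hbb (m+3) (by omega)
    have hc := hcond (m+1) (by omega)
    have p1 := (hA (m+2) (by omega)).mul (hw.inv hb3)
    have p2 := p1.weaken (b := b (m+2)) (by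
      simp only [show m + 1 + 2 = m + 3 by rfl, show m + 1 + 1 = m + 2 by rfl] at hc ⊢
      linarith)
    refine ⟨fun q => (B (m+2) q - A (m+2) q * (w q)⁻¹) * (D (m+2) q)⁻¹, ?_, ?_⟩
    · exact (((hB (m+2) (by omega) (by omega)).sub p2).mul (hD'.inv one_ne_zero)).cast
        (by ring) (by simp)
    · filter_upwards [hrec m, hD'.ev_ne one_ne_zero, hw', hw.ev_ne hb3] with q h1 h2 h3 h4
      have h5 : u (m+2) q = (w q)⁻¹ * u (m+1) q := by
        rw [h3, ← mul_assoc, inv_mul_cancel₀ h4, one_mul]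
      rw [h5] at h1
      have : u m q = (u m q * D (m+2) q) * (D (m+2) q)⁻¹ := by
        rw [mul_assoc, mul_inv_cancel₀ h2, mul_one]
      rw [this]
      have : u m q * D (m+2) q = (B (m+2) q - A (m+2) q * (w q)⁻¹) * u (m+1) q := by linarith
      rw [this]; ring

lemma newton (u : ℕ → ℝ → ℝ) (N : ℕ) (e κ : ℕ → ℝ)
    (he : ∀ i j, 1 ≤ i → i < j → j ≤ N → e j < e i) (hκ : ∀ i, κ i ≠ 0)
    (hu : ∀ n, n ≤ N → As (u n) (∑ i ∈ Finset.range n, (-e (i+1)))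
      (∏ i ∈ Finset.range n, (-(κ (i+1))⁻¹))) (p : ℕ) (hp : p + 1 ≤ N) (s : ℝ) :
    As (fun q => ∑ n ∈ Finset.range (N+1), u n q * (s * κ (p+1) * q ^ e (p+1)) ^ n)
      (∑ i ∈ Finset.range p, (-e (i+1)) + p * e (p+1))
      ((∏ i ∈ Finset.range p, (-(κ (i+1))⁻¹)) * (s * κ (p+1)) ^ p * (1 - s)) := by
  set g : ℕ → ℝ := fun n => ∑ i ∈ Finset.range n, (-e (i+1)) + n * e (p+1) with hg
  have hstep : ∀ n, g (n+1) = g n + (e (p+1) - e (n+1)) := by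
    intro n
    simp only [hg, Finset.sum_range_succ]; push_cast; ring
  have hlow : ∀ m n, n + m + 1 = p → g p < g n := by
    intro m
    induction m with
    | zero =>
      intro n h
      have h1 := hstep n
      have h2 := he (n+1) (p+1) (by omega) (by omega) hp
      rw [show n + 1 = p by omega] at h1 h2
      linarith
    | succ m ih =>
      intro n h
      have h1 := hstep n
      have h2 := he (n+1) (p+1) (by omega) (by omega) hp
      have h3 := ih (n+1) (by omega)
      linarith
  have heq : g (p+1) = g p := by rw [hstep]; ring
  have hhigh : ∀ m, p + 1 + m + 1 ≤ N → g p < g (p+1+m+1) := by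
    intro m
    induction m with
    | zero =>
      intro h
      have h1 := hstep (p+1)
      have h2 := he (p+1) (p+1+1) (by omega) (by omega) (by omega)
      simp only [add_zero]
      linarith
    | succ m ih =>
      intro h
      have h1 := hstep (p+1+m+1)
      have h2 := he (p+1) (p+1+m+1+1) (by omega) (by omega) (by omega)
      have h3 := ih (by omega)
      rw [show p + 1 + (m+1) + 1 = p+1+m+1+1 by ring]
      linarith
  have hterm : ∀ n, n ≤ N → As (fun q => u n q * (s * κ (p+1) * q ^ e (p+1)) ^ n) (g n)
      ((∏ i ∈ Finset.range n, (-(κ (i+1))⁻¹)) * (s * κ (p+1)) ^ n) := by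
    intro n hn
    have h := (hu n hn).mul ((((As.const (s * κ (p+1))).mul (As.rpow (e (p+1)))).pow n))
    exact h.cast (by simp [hg]) (by simp)
  set G : ℝ := (∏ i ∈ Finset.range p, (-(κ (i+1))⁻¹)) * (s * κ (p+1)) ^ p with hG
  have hall : ∀ n ∈ Finset.range (N+1),
      As (fun q => u n q * (s * κ (p+1) * q ^ e (p+1)) ^ n) (g p)
        ((if n = p then G else 0) + (if n = p + 1 then -s * G else 0)) := by
    intro n hn
    rw [Finset.mem_range] at hn
    have ht := hterm n (by omega)
    rcases lt_trichotomy n p with h | h | h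
    · refine (ht.weaken (hlow (p - n - 1) n (by omega))).cast rfl ?_
      rw [if_neg (by omega), if_neg (by omega)]; simp
    · subst h
      exact ht.cast rfl (by simp [hG])
    · by_cases h' : n = p + 1
      · subst h'
        refine ht.cast heq ?_
        have := hκ (p+1)
        rw [if_neg (by omega), if_pos rfl, hG, Finset.prod_range_succ]
        field_simp
        ring
      · have := hhigh (n - p - 2) (by omega)
        rw [show p + 1 + (n - p - 2) + 1 = n by omega] at this
        refine (ht.weaken this).cast rfl ?_
        rw [if_neg (by omega), if_neg (by omega)]; simp
  refine (As.sum hall).cast rfl ?_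
  rw [Finset.sum_add_distrib, Finset.sum_ite_eq', Finset.sum_ite_eq',
    if_pos (by simp; omega), if_pos (by simp; omega)]
  ring

lemma ivt_neg {f : ℝ → ℝ} (hf : Continuous f) {a b : ℝ} (hab : a < b) (h : f a * f b < 0) :
    ∃ x ∈ Ioo a b, f x = 0 := by
  rcases mul_neg_iff.1 h with ⟨h1, h2⟩ | ⟨h1, h2⟩
  · exact intermediate_value_Ioo' hab.le hf.continuousOn ⟨h2, h1⟩
  · exact intermediate_value_Ioo hab.le hf.continuousOn ⟨h1, h2⟩

/-- continuity of a unique, sign changing zero -/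
lemma cont_zero (F : ℝ → ℝ → ℝ) (S : Set ℝ) (a b : ℝ) (σ : ℝ → ℝ)
    (hF : ∀ q ∈ S, Continuous (F q))
    (hFq : ∀ s ∈ Icc a b, ContinuousOn (fun q => F q s) S)
    (hsgn : ∀ q ∈ S, F q a * F q b < 0)
    (hσ : ∀ q ∈ S, σ q ∈ Ioo a b ∧ F q (σ q) = 0)
    (huniq : ∀ q ∈ S, ∀ s ∈ Icc a b, F q s = 0 → s = σ q) :
    ContinuousOn σ S := by
  intro q hq
  have key : ∀ s s', a ≤ s → s < σ q → σ q < s' → s' ≤ b → F q s * F q s' < 0 := by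
    intro s s' h1 h2 h3 h4
    obtain ⟨⟨_, _⟩, _⟩ := hσ q hq
    have A : 0 ≤ F q a * F q s := by
      by_contra! hneg
      rcases h1.eq_or_lt with h | h
      · subst h; nlinarith [mul_self_nonneg (F q a)]
      obtain ⟨x, hx, hx0⟩ := ivt_neg (hF q hq) h hneg
      have := huniq q hq x ⟨hx.1.le, by linarith [hx.2]⟩ hx0
      linarith [hx.2]
    have B : 0 ≤ F q s' * F q b := by
      by_contra! hneg
      rcases h4.eq_or_lt with h | h
      · subst h; nlinarith [mul_self_nonneg (F q s')]
      obtain ⟨x, hx, hx0⟩ := ivt_neg (hF q hq) h hneg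
      have := huniq q hq x ⟨by linarith [hx.1], hx.2.le⟩ hx0
      linarith [hx.1]
    have n1 : F q s ≠ 0 := fun h => by
      have := huniq q hq s ⟨h1, by linarith⟩ h
      linarith
    have n2 : F q s' ≠ 0 := fun h => by
      have := huniq q hq s' ⟨by linarith, h4⟩ h
      linarith
    have n3 := hsgn q hq
    have A' : 0 < F q a * F q s := lt_of_le_of_ne A
      (Ne.symm (mul_ne_zero (fun h => by rw [h] at n3; simp at n3) n1))
    have B' : 0 < F q s' * F q b := lt_of_le_of_ne B
      (Ne.symm (mul_ne_zero n2 (fun h => by rw [h] at n3; simp at n3)))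
    by_contra! hc
    have h5 := mul_pos A' B'
    nlinarith
  rw [ContinuousWithinAt, Metric.tendsto_nhds]
  intro ε hε
  obtain ⟨⟨ha, hb⟩, h0⟩ := hσ q hq
  set s := max a (σ q - ε/2)
  set s' := min b (σ q + ε/2)
  have hs : s < σ q := max_lt ha (by linarith)
  have hs' : σ q < s' := lt_min hb (by linarith)
  have has : a ≤ s := le_max_left _ _
  have hsb : s' ≤ b := min_le_left _ _
  have hse : σ q - ε/2 ≤ s := le_max_right _ _
  have hse' : s' ≤ σ q + ε/2 := min_le_right _ _
  have hk := key s s' has hs hs' hsb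
  have hcont : ContinuousWithinAt (fun q => F q s * F q s') S q :=
    (hFq s ⟨has, by linarith⟩ q hq).mul (hFq s' ⟨by linarith, hsb⟩ q hq)
  filter_upwards [hcont.eventually_lt_const hk, self_mem_nhdsWithin] with r hr hrS
  obtain ⟨x, hx, hx0⟩ := ivt_neg (hF r hrS) (hs.trans hs') hr
  have := huniq r hrS x ⟨by linarith [hx.1], by linarith [hx.2]⟩ hx0
  rw [← this, Real.dist_eq, abs_lt]
  constructor <;> linarith [hx.1, hx.2]

lemma ev_disj (κ e : ℕ → ℝ) (hκ : ∀ i, κ i ≠ 0) (i j : ℕ) (h : e j ≠ e i) :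
    ∀ᶠ q : ℝ in nhdsWithin 0 (Ioi 0), ∀ s ∈ Icc (1/2 : ℝ) (3/2), ∀ s' ∈ Icc (1/2 : ℝ) (3/2),
      s * κ i * q ^ e i ≠ s' * κ j * q ^ e j := by
  wlog hlt : e j < e i generalizing i j
  · have := this j i h.symm (lt_of_le_of_ne (not_lt.1 hlt) h.symm)
    filter_upwards [this] with q hq s hs s' hs'
    exact (hq s' hs' s hs).symm
  have hpos : 0 < |κ j| / (3 * |κ i|) := by
    have := abs_pos.2 (hκ i); have := abs_pos.2 (hκ j); positivity
  filter_upwards [ev_pos, (rpow_tendsto_zero (sub_pos.2 hlt)).eventually_lt_const hpos]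
    with q hq h1 s hs s' hs' heq
  have h2 : q ^ e i = q ^ (e i - e j) * q ^ e j := by
    rw [← Real.rpow_add hq]; congr 1; ring
  have h3 := Real.rpow_pos_of_pos hq (e j)
  have h4 := Real.rpow_pos_of_pos hq (e i - e j)
  rw [h2, ← mul_assoc] at heq
  have h5 := mul_right_cancel₀ h3.ne' heq
  have h6 := congrArg abs h5
  have hi := abs_pos.2 (hκ i)
  have hj := abs_pos.2 (hκ j)
  rw [abs_mul, abs_mul, abs_mul, abs_of_pos h4, abs_of_pos (show 0 < s by linarith [hs.1]),
    abs_of_pos (show 0 < s' by linarith [hs'.1])] at h6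
  rw [lt_div_iff₀ (by positivity)] at h1
  have h7 : s * |κ i| * q ^ (e i - e j) ≤ 3/2 * |κ i| * q ^ (e i - e j) := by
    gcongr; exact hs.2
  have h8 : 1/2 * |κ j| ≤ s' * |κ j| := by
    gcongr; exact hs'.1
  nlinarith

lemma zeros (P : ℝ → ℝ[X]) (M : ℕ) (κ e : ℕ → ℝ) (hκ : ∀ i, κ i ≠ 0)
    (he : ∀ i j, 1 ≤ i → i < j → j ≤ M → e j < e i) (q₀ : ℝ) (hq₀ : 0 < q₀)
    (hdeg : ∀ q ∈ Ioo 0 q₀, (P q).natDegree ≤ M)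
    (hcont : ∀ j, 1 ≤ j → j ≤ M → ∀ s : ℝ,
      ContinuousOn (fun q => (P q).eval (s * κ j * q ^ e j)) (Ioo 0 q₀))
    (hsign : ∀ j, 1 ≤ j → j ≤ M → ∀ s s' : ℝ, 0 < s → s < 1 → 1 < s' →
      ∀ᶠ q in nhdsWithin 0 (Ioi 0),
        (P q).eval (s * κ j * q ^ e j) * (P q).eval (s' * κ j * q ^ e j) < 0) :
    ∃ q₁ ∈ Ioo (0 : ℝ) 1, q₁ ≤ q₀ ∧ ∃ σ : ℕ → ℝ → ℝ, ∀ j, 1 ≤ j → j ≤ M →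
      ContinuousOn (σ j) (Ioo 0 q₁) ∧
      (∀ q ∈ Ioo 0 q₁, (P q).eval (σ j q * κ j * q ^ e j) = 0) ∧
      Tendsto (σ j) (nhdsWithin 0 (Ioi 0)) (nhds 1) ∧
      ∀ q ∈ Ioo 0 q₁, ∀ s ∈ Icc (1/2 : ℝ) (3/2), (P q).eval (s * κ j * q ^ e j) = 0 →
        s = σ j q := by
  have E1 : ∀ᶠ q : ℝ in nhdsWithin 0 (Ioi 0), ∀ j ∈ Finset.Icc 1 M,
      (P q).eval (1/2 * κ j * q ^ e j) * (P q).eval (3/2 * κ j * q ^ e j) < 0 := by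
    rw [Filter.eventually_all_finset]
    intro j hj
    rw [Finset.mem_Icc] at hj
    exact hsign j hj.1 hj.2 _ _ (by norm_num) (by norm_num) (by norm_num)
  have E2 : ∀ᶠ q : ℝ in nhdsWithin 0 (Ioi 0), ∀ i ∈ Finset.Icc 1 M, ∀ j ∈ Finset.Icc 1 M,
      i ≠ j → ∀ s ∈ Icc (1/2 : ℝ) (3/2), ∀ s' ∈ Icc (1/2 : ℝ) (3/2),
      s * κ i * q ^ e i ≠ s' * κ j * q ^ e j := by
    rw [Filter.eventually_all_finset]
    intro i hi
    rw [Filter.eventually_all_finset]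
    intro j hj
    rw [Finset.mem_Icc] at hi hj
    by_cases hij : i = j
    · filter_upwards with q h; exact absurd hij h
    · have : e j ≠ e i := by
        rcases lt_or_gt_of_ne hij with h | h
        · exact (he i j hi.1 h hj.2).ne
        · exact (he j i hj.1 h hi.2).ne'
      filter_upwards [ev_disj κ e hκ i j this] with q hq _
      exact hq
  obtain ⟨r, hr0, hr⟩ := mem_nhdsGT_iff_exists_Ioo_subset.1 (E1.and E2)
  have hr0 : 0 < r := hr0
  set q₁ := min (min r q₀) (1/2) with hq₁
  have hq₁0 : 0 < q₁ := lt_min (lt_min hr0 hq₀) (by norm_num)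
  have hq₁r : q₁ ≤ r := (min_le_left _ _).trans (min_le_left _ _)
  have hq₁q : q₁ ≤ q₀ := (min_le_left _ _).trans (min_le_right _ _)
  have hS : ∀ q ∈ Ioo 0 q₁, _ := fun q hq => hr ⟨hq.1, hq.2.trans_le hq₁r⟩
  have hS0 : ∀ q ∈ Ioo 0 q₁, q ∈ Ioo 0 q₀ := fun q hq => ⟨hq.1, hq.2.trans_le hq₁q⟩
  have hFc : ∀ j q, Continuous (fun s : ℝ => (P q).eval (s * κ j * q ^ e j)) := by
    intro j q
    exact (P q).continuous.comp (by fun_prop)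
  have hex : ∀ q j, ∃ s : ℝ, q ∈ Ioo 0 q₁ → 1 ≤ j → j ≤ M →
      s ∈ Ioo (1/2 : ℝ) (3/2) ∧ (P q).eval (s * κ j * q ^ e j) = 0 := by
    intro q j
    by_cases h : q ∈ Ioo 0 q₁ ∧ 1 ≤ j ∧ j ≤ M
    · obtain ⟨s, hs, hs0⟩ := ivt_neg (hFc j q) (show (1/2 : ℝ) < 3/2 by norm_num)
        ((hS q h.1).1 j (Finset.mem_Icc.2 h.2))
      exact ⟨s, fun _ _ _ => ⟨hs, hs0⟩⟩
    · exact ⟨0, fun h1 h2 h3 => absurd ⟨h1, h2, h3⟩ h⟩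
  choose τ hτ using hex
  have huniq : ∀ j, 1 ≤ j → j ≤ M → ∀ q ∈ Ioo 0 q₁, ∀ s ∈ Icc (1/2 : ℝ) (3/2),
      (P q).eval (s * κ j * q ^ e j) = 0 → s = τ q j := by
    intro j hj1 hj2 q hq s hs hs0
    by_contra hne
    have hP : P q ≠ 0 := by
      intro h
      have := (hS q hq).1 j (Finset.mem_Icc.2 ⟨hj1, hj2⟩)
      simp [h] at this
    set R : Finset ℝ := (Finset.Icc 1 M).image (fun i => τ q i * κ i * q ^ e i) with hR
    have hcard : R.card = M := by
      rw [hR, Finset.card_image_of_injOn]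
      · simp
      · intro i hi i' hi' hii
        by_contra hne'
        have hi := Finset.mem_coe.1 hi
        have hi' := Finset.mem_coe.1 hi'
        have m1 := Finset.mem_Icc.1 hi
        have m2 := Finset.mem_Icc.1 hi'
        exact (hS q hq).2 i hi i' hi' hne' _ (Ioo_subset_Icc_self (hτ q i hq m1.1 m1.2).1) _
          (Ioo_subset_Icc_self (hτ q i' hq m2.1 m2.2).1) hii
    have hnot : s * κ j * q ^ e j ∉ R := by
      intro hmem
      obtain ⟨i, hi, hii⟩ := Finset.mem_image.1 hmem
      have m1 := Finset.mem_Icc.1 hi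
      by_cases hij : i = j
      · subst hij
        have h1 := mul_right_cancel₀ (Real.rpow_pos_of_pos hq.1 (e i)).ne' hii
        exact hne (mul_right_cancel₀ (hκ i) h1).symm
      · exact (hS q hq).2 i hi j (Finset.mem_Icc.2 ⟨hj1, hj2⟩) hij _
          (Ioo_subset_Icc_self (hτ q i hq m1.1 m1.2).1) _ hs hii
    have hsub : (insert (s * κ j * q ^ e j) R).val ⊆ (P q).roots := by
      intro x hx
      rw [Finset.mem_val, Finset.mem_insert] at hx
      rw [mem_roots hP]
      rcases hx with rfl | hx
      · exact hs0
      · obtain ⟨i, hi, rfl⟩ := Finset.mem_image.1 hx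
        have m1 := Finset.mem_Icc.1 hi
        exact (hτ q i hq m1.1 m1.2).2
    have h1 := card_le_degree_of_subset_roots hsub
    rw [Finset.card_insert_of_notMem hnot, hcard] at h1
    have h2 := hdeg q (hS0 q hq)
    omega
  refine ⟨q₁, ⟨hq₁0, (min_le_right _ _).trans_lt (by norm_num)⟩, hq₁q, fun j q => τ q j, ?_⟩
  intro j hj1 hj2
  refine ⟨?_, ?_, ?_, ?_⟩
  · refine cont_zero (fun q s => (P q).eval (s * κ j * q ^ e j)) (Ioo 0 q₁) (1/2) (3/2) _
      (fun q _ => hFc j q) ?_ ?_ ?_ ?_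
    · intro s _
      exact (hcont j hj1 hj2 s).mono hS0
    · intro q hq
      exact (hS q hq).1 j (Finset.mem_Icc.2 ⟨hj1, hj2⟩)
    · intro q hq
      exact hτ q j hq hj1 hj2
    · intro q hq s hs h0
      exact huniq j hj1 hj2 q hq s hs h0
  · intro q hq
    exact (hτ q j hq hj1 hj2).2
  · rw [Metric.tendsto_nhds]
    intro ε hε
    set δ := min (ε/2) (1/4) with hδ
    have d0 : 0 < δ := lt_min (by linarith) (by norm_num)
    have d1 : δ ≤ ε/2 := min_le_left _ _
    have d2 : δ ≤ 1/4 := min_le_right _ _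
    filter_upwards [hsign j hj1 hj2 (1-δ) (1+δ) (by linarith) (by linarith) (by linarith),
      Ioo_mem_nhdsGT hq₁0] with q h1 hq
    obtain ⟨x, hx, hx0⟩ := ivt_neg (hFc j q) (show 1 - δ < 1 + δ by linarith) h1
    rw [← huniq j hj1 hj2 q hq x ⟨by linarith [hx.1], by linarith [hx.2]⟩ hx0,
      Real.dist_eq, abs_lt]
    constructor <;> linarith [hx.1, hx.2]
  · intro q hq s hs h0
    exact huniq j hj1 hj2 q hq s hs h0

noncomputable def fA (h₁ h₂ β t₁ t₂ : ℝ) (n : ℕ) (q : ℝ) : ℝ :=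
  t₁ * t₂ * q ^ (h₁ + h₂) * (1 - q ^ (n : ℝ)) * (1 - q ^ ((n : ℝ) - β))

noncomputable def fB (h₁ h₂ l₁ l₂ α₁ α₂ t₁ t₂ lam : ℝ) (n : ℕ) (q : ℝ) : ℝ :=
  q ^ ((1 : ℝ)/2) * (q ^ h₁ * t₁ + q ^ h₂ * t₂)
    + (q ^ l₁ * t₁ + q ^ l₂ * t₂) * q ^ (2 * ((n : ℝ) + lam) + α₁ + α₂ - 5/2)

noncomputable def fD (α₁ α₂ lam : ℝ) (n : ℕ) (q : ℝ) : ℝ :=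
  q * (1 - q ^ ((n : ℝ) - 2 + lam + α₁)) * (1 - q ^ ((n : ℝ) - 2 + lam + α₂))

lemma fA_ne {h₁ h₂ β t₁ t₂ : ℝ} (hβ : β < 1) (ht₁ : 0 < t₁) (ht₂ : 0 < t₂) (n : ℕ) (hn : 1 ≤ n)
    (q : ℝ) (hq : q ∈ Ioo (0:ℝ) 1) : fA h₁ h₂ β t₁ t₂ n q ≠ 0 := by
  have hn' : (1:ℝ) ≤ n := by exact_mod_cast hn
  have h1 : q ^ (n : ℝ) < 1 := Real.rpow_lt_one hq.1.le hq.2 (by linarith)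
  have h2 : q ^ ((n : ℝ) - β) < 1 := Real.rpow_lt_one hq.1.le hq.2 (by linarith)
  have h3 := Real.rpow_pos_of_pos hq.1 (h₁ + h₂)
  have h4 : 0 < 1 - q ^ (n : ℝ) := by linarith
  have h5 : 0 < 1 - q ^ ((n : ℝ) - β) := by linarith
  unfold fA
  positivity

lemma fA_as {h₁ h₂ β t₁ t₂ : ℝ} (hβ : β < 1) (n : ℕ) (hn : 1 ≤ n) :
    As (fA h₁ h₂ β t₁ t₂ n) (h₁ + h₂) (t₁ * t₂) := by
  have hn' : (1:ℝ) ≤ n := by exact_mod_cast hn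
  exact ((((As.const (t₁ * t₂)).mul (As.rpow (h₁ + h₂))).mul
    (As.one_sub_pos (show 0 < (n:ℝ) by linarith))).mul
    (As.one_sub_pos (show 0 < (n:ℝ) - β by linarith))).cast (by ring) (by ring)

lemma fB_as {h₁ h₂ l₁ l₂ α₁ α₂ β t₁ t₂ lam : ℝ}
    (hlam : lam = (h₁ + h₂ - l₁ - l₂ - α₁ - α₂ - β + 2) / 2)
    (hh : h₁ < h₂) (hl : l₁ < l₂) (hyp1 : 0 < 1 + h₂ - l₂ - β) (n : ℕ) (hn : 1 ≤ n) :
    As (fB h₁ h₂ l₁ l₂ α₁ α₂ t₁ t₂ lam n) (1/2 + h₁) t₁ := by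
  have hn' : (1:ℝ) ≤ n := by exact_mod_cast hn
  have p1 : As (fun q : ℝ => q ^ h₁ * t₁ + q ^ h₂ * t₂) h₁ t₁ :=
    (((As.rpow h₁).mul (As.const t₁)).cast (a' := h₁) (C' := t₁) (by ring) (by ring)).add
      (((As.rpow h₂).mul (As.const t₂)).weaken (b := h₁) (by linarith)) |>.cast rfl (by ring)
  have p2 : As (fun q : ℝ => q ^ l₁ * t₁ + q ^ l₂ * t₂) l₁ t₁ :=
    (((As.rpow l₁).mul (As.const t₁)).cast (a' := l₁) (C' := t₁) (by ring) (by ring)).add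
      (((As.rpow l₂).mul (As.const t₂)).weaken (b := l₁) (by linarith)) |>.cast rfl (by ring)
  exact (((As.rpow (1/2)).mul p1).add ((p2.mul (As.rpow
    (2 * ((n : ℝ) + lam) + α₁ + α₂ - 5/2))).weaken (b := 1/2 + h₁) (by
      rw [hlam]; linarith))).cast rfl (by ring)

lemma fD_as {h₁ h₂ l₁ l₂ α₁ α₂ β lam : ℝ}
    (hlam : lam = (h₁ + h₂ - l₁ - l₂ - α₁ - α₂ - β + 2) / 2)
    (N : ℕ) (hN : (N : ℝ) = -lam - α₁) (hα : α₂ - α₁ < 1) (n : ℕ) (hn : n ≤ N + 1) :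
    As (fD α₁ α₂ lam n) (2 * n - 1 + h₁ + h₂ - l₁ - l₂ - β) 1 := by
  have hn' : (n:ℝ) ≤ N + 1 := by exact_mod_cast hn
  have p0 : As (fun q : ℝ => q) 1 1 := by simpa using As.rpow 1
  exact ((p0.mul (As.one_sub_neg (show (n : ℝ) - 2 + lam + α₁ < 0 by linarith))).mul
    (As.one_sub_neg (show (n : ℝ) - 2 + lam + α₂ < 0 by linarith))).cast
      (by rw [hlam]; ring) (by ring)

lemma full_B {h₁ h₂ l₁ l₂ α₁ α₂ β t₁ t₂ lam : ℝ}
    (hlam : lam = (h₁ + h₂ - l₁ - l₂ - α₁ - α₂ - β + 2) / 2)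
    (hh : h₁ < h₂) (hl : l₁ < l₂) (hyp1 : 0 < 1 + h₂ - l₂ - β) (k : ℕ) (E : ℝ → ℝ) (s : ℝ)
    (hE : As E (3/2 - k + h₁ - lam) (-(s * t₁))) (n : ℕ) (hn : 1 ≤ n) :
    As (fun q => E q * q ^ ((n:ℝ) - 1 + lam) + fB h₁ h₂ l₁ l₂ α₁ α₂ t₁ t₂ lam n q)
      (1/2 + h₁ + (if n < k then (n:ℝ) - k else 0))
      (if n < k then -(s * t₁) else if n = k then (1 - s) * t₁ else t₁) := by
  have p1 := hE.mul (As.rpow ((n:ℝ) - 1 + lam))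
  have p2 := fB_as (α₁ := α₁) (α₂ := α₂) (t₁ := t₁) (t₂ := t₂) hlam hh hl hyp1 n hn
  rcases lt_trichotomy n k with h | h | h
  · have h' : (n:ℝ) < k := by exact_mod_cast h
    rw [if_pos h, if_pos h]
    have p3 := p2.weaken (b := 1/2 + h₁ + ((n:ℝ) - k)) (by linarith)
    exact ((p1.cast (by ring) rfl).add p3).cast rfl (by ring)
  · subst h
    rw [if_neg (lt_irrefl _), if_neg (lt_irrefl _), if_pos rfl]
    exact ((p1.cast (by ring) rfl).add (p2.cast (by ring) rfl)).cast rfl (by ring)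
  · have h' : (k:ℝ) < n := by exact_mod_cast h
    rw [if_neg (by omega), if_neg (by omega), if_neg (by omega), add_zero]
    have p3 := p1.weaken (b := 1/2 + h₁) (by linarith)
    exact (p3.add p2).cast rfl (by ring)

set_option maxHeartbeats 4000000 in
/-- ultradiscrete asymptotics of the zeros of the terminating (Heun
polynomial) solution `Σ_{n=0}^{N} cₙ(E_{N+2-k}(q)) xⁿ` of the q-Heun equation. -/
theorem stmt17 (h₁ h₂ l₁ l₂ α₁ α₂ β t₁ t₂ lam : ℝ)
    (hlam : lam = (h₁ + h₂ - l₁ - l₂ - α₁ - α₂ - β + 2) / 2)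
    (N : ℕ) (hN : (N : ℝ) = -lam - α₁)
    (hβ : β < 1) (hα : α₂ - α₁ < 1) (ht₁ : 0 < t₁) (ht₂ : 0 < t₂)
    (hh : h₁ < h₂) (hl : l₁ < l₂)
    (hyp1 : 0 < 1 + h₂ - l₂ - β) (hyp2 : 0 < 2 + 2 * h₂ - l₁ - l₂ - β)
    (k : ℕ) (hk1 : 1 ≤ k) (hk2 : k ≤ N + 1)
    (c : ℕ → ℝ → Polynomial ℝ) (hc0 : ∀ q, c 0 q = 1)
    (hc1 : ∀ q ∈ Ioo (0 : ℝ) 1,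
      c 1 q * C (t₁ * t₂ * q ^ (h₁ + h₂) * (1 - q ^ (1 : ℝ)) * (1 - q ^ ((1 : ℝ) - β)))
      = c 0 q * (X * C (q ^ ((1 : ℝ) - 1 + lam))
          + C (q ^ ((1 : ℝ)/2) * (q ^ h₁ * t₁ + q ^ h₂ * t₂)
              + (q ^ l₁ * t₁ + q ^ l₂ * t₂) * q ^ (2 * ((1 : ℝ) + lam) + α₁ + α₂ - 5/2))))
    (hrec : ∀ q ∈ Ioo (0 : ℝ) 1, ∀ n : ℕ, 2 ≤ n →
      c n q * C (t₁ * t₂ * q ^ (h₁ + h₂) * (1 - q ^ (n : ℝ)) * (1 - q ^ ((n : ℝ) - β)))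
      = c (n - 1) q * (X * C (q ^ ((n : ℝ) - 1 + lam))
          + C (q ^ ((1 : ℝ)/2) * (q ^ h₁ * t₁ + q ^ h₂ * t₂)
              + (q ^ l₁ * t₁ + q ^ l₂ * t₂) * q ^ (2 * ((n : ℝ) + lam) + α₁ + α₂ - 5/2)))
        - c (n - 2) q
            * C (q * (1 - q ^ ((n : ℝ) - 2 + lam + α₁)) * (1 - q ^ ((n : ℝ) - 2 + lam + α₂))))
    (Ev : ℝ → ℝ)
    (hEroot : ∀ q ∈ Ioo (0 : ℝ) 1, (c (N + 1) q).eval (Ev q) = 0)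
    (hEasym : Tendsto (fun q : ℝ => Ev q / (-(q ^ ((3 : ℝ)/2 - (k : ℝ) + h₁ - lam) * t₁)))
      (nhdsWithin 0 (Ioi 0)) (nhds 1)) :
    ∃ q₀ ∈ Ioo (0 : ℝ) 1, ∃ xz : ℕ → ℝ → ℝ,
      (∀ j, 1 ≤ j → j ≤ N → ContinuousOn (xz j) (Ioo (0 : ℝ) q₀))
      ∧ (∀ q ∈ Ioo (0 : ℝ) q₀, ∀ j, 1 ≤ j → j ≤ N →
          ∑ n ∈ Finset.range (N + 1), (c n q).eval (Ev q) * xz j q ^ n = 0)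
      ∧ (∀ j, 1 ≤ j → j < k →
          Tendsto (fun q : ℝ => xz j q / (q ^ ((j : ℝ) - 1/2 + h₂) * t₂))
            (nhdsWithin 0 (Ioi 0)) (nhds 1))
      ∧ (∀ j, k ≤ j → j ≤ N →
          Tendsto (fun q : ℝ => xz j q / (-(q ^ (-2 * (j : ℝ) - 1/2 - h₂ + l₁ + l₂ + β) * t₁)))
            (nhdsWithin 0 (Ioi 0)) (nhds 1)) := by
  set A := fA h₁ h₂ β t₁ t₂ with hAdef
  set B0 := fB h₁ h₂ l₁ l₂ α₁ α₂ t₁ t₂ lam with hBdef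
  set D := fD α₁ α₂ lam with hDdef
  have R1 : ∀ q ∈ Ioo (0:ℝ) 1, c 1 q * C (A 1 q) =
      X * C (q ^ (((1:ℕ) : ℝ) - 1 + lam)) + C (B0 1 q) := by
    intro q hq
    have := hc1 q hq
    rw [hc0, one_mul] at this
    simpa only [hAdef, hBdef, fA, fB, Nat.cast_one] using this
  have R2 : ∀ q ∈ Ioo (0:ℝ) 1, ∀ n : ℕ, c (n+2) q * C (A (n+2) q) =
      c (n+1) q * (X * C (q ^ (((n+2:ℕ) : ℝ) - 1 + lam)) + C (B0 (n+2) q))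
        - c n q * C (D (n+2) q) := by
    intro q hq n
    exact hrec q hq (n+2) (by omega)
  have hAne : ∀ n, 1 ≤ n → ∀ q ∈ Ioo (0:ℝ) 1, A n q ≠ 0 := fun n hn q hq =>
    fA_ne hβ ht₁ ht₂ n hn q hq
  have S1 : ∀ (x : ℝ), ∀ q ∈ Ioo (0:ℝ) 1, (c 1 q).eval x * A 1 q =
      x * q ^ (((1:ℕ) : ℝ) - 1 + lam) + B0 1 q := by
    intro x q hq
    have := congrArg (eval x) (R1 q hq)
    simpa only [eval_mul, eval_add, eval_sub, eval_X, eval_C] using this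
  have S2 : ∀ (x : ℝ), ∀ q ∈ Ioo (0:ℝ) 1, ∀ n : ℕ, (c (n+2) q).eval x * A (n+2) q =
      (c (n+1) q).eval x * (x * q ^ (((n+2:ℕ) : ℝ) - 1 + lam) + B0 (n+2) q)
        - (c n q).eval x * D (n+2) q := by
    intro x q hq n
    have := congrArg (eval x) (R2 q hq n)
    simpa only [eval_mul, eval_add, eval_sub, eval_X, eval_C] using this
  -- degrees
  have hdeg : ∀ q ∈ Ioo (0:ℝ) 1, ∀ n, (c n q).natDegree ≤ n := by
    intro q hq n
    induction n using Nat.strong_induction_on with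
    | _ n ih =>
      match n, ih with
      | 0, _ => simp [hc0]
      | 1, _ =>
        rw [← natDegree_mul_C (hAne 1 le_rfl q hq), R1 q hq]
        compute_degree
      | m+2, ih =>
        have i1 := ih (m+1) (by omega)
        have i0 := ih m (by omega)
        rw [← natDegree_mul_C (hAne (m+2) (by omega) q hq), R2 q hq m]
        refine (natDegree_sub_le _ _).trans (max_le ?_ ?_)
        · refine natDegree_mul_le.trans ?_
          have : (X * C (q ^ (((m+2:ℕ) : ℝ) - 1 + lam)) + C (B0 (m+2) q)).natDegree ≤ 1 := by
            compute_degree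
          omega
        · refine natDegree_mul_le.trans ?_
          rw [natDegree_C]; omega
  -- continuity
  have hpc : ∀ (r : ℝ) (q₁ : ℝ), ContinuousOn (fun q : ℝ => q ^ r) (Ioo 0 q₁) := by
    intro r q₁ q hq
    exact (Real.continuousAt_rpow_const q r (Or.inl hq.1.ne')).continuousWithinAt
  have hAc : ∀ n q₁, ContinuousOn (A n) (Ioo 0 q₁) := by
    intro n q₁
    have := hpc (h₁+h₂) q₁
    have := hpc n q₁
    have := hpc (n-β) q₁
    simp only [hAdef]; unfold fA
    fun_prop
  have hBc : ∀ n q₁, ContinuousOn (B0 n) (Ioo 0 q₁) := by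
    intro n q₁
    have := hpc h₁ q₁
    have := hpc h₂ q₁
    have := hpc l₁ q₁
    have := hpc l₂ q₁
    have := hpc (1/2) q₁
    have := hpc (2 * ((n : ℝ) + lam) + α₁ + α₂ - 5/2) q₁
    simp only [hBdef]; unfold fB
    fun_prop
  have hDc : ∀ n q₁, ContinuousOn (D n) (Ioo 0 q₁) := by
    intro n q₁
    have := hpc ((n : ℝ) - 2 + lam + α₁) q₁
    have := hpc ((n : ℝ) - 2 + lam + α₂) q₁
    simp only [hDdef]; unfold fD
    fun_prop
  have hcc : ∀ q₁ ≤ (1:ℝ), ∀ E : ℝ → ℝ, ContinuousOn E (Ioo 0 q₁) → ∀ n,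
      ContinuousOn (fun q => (c n q).eval (E q)) (Ioo 0 q₁) := by
    intro q₁ hq₁ E hE n
    have hsub : ∀ q ∈ Ioo 0 q₁, q ∈ Ioo (0:ℝ) 1 := fun q hq => ⟨hq.1, hq.2.trans_le hq₁⟩
    induction n using Nat.strong_induction_on with
    | _ n ih =>
      match n, ih with
      | 0, _ => simp [hc0]; exact continuousOn_const
      | 1, _ =>
        refine ContinuousOn.congr (f := fun q => (E q * q ^ (((1:ℕ) : ℝ) - 1 + lam) + B0 1 q) / A 1 q)
          (((hE.mul (hpc _ q₁)).add (hBc 1 q₁)).div (hAc 1 q₁)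
            (fun q hq => hAne 1 le_rfl q (hsub q hq))) ?_
        intro q hq
        exact (eq_div_iff (hAne 1 le_rfl q (hsub q hq))).2 (S1 (E q) q (hsub q hq))
      | m+2, ih =>
        have i1 := ih (m+1) (by omega)
        have i0 := ih m (by omega)
        refine ContinuousOn.congr (f := fun q => ((c (m+1) q).eval (E q) *
          (E q * q ^ (((m+2:ℕ) : ℝ) - 1 + lam) + B0 (m+2) q)
            - (c m q).eval (E q) * D (m+2) q) / A (m+2) q)
          (((i1.mul ((hE.mul (hpc _ q₁)).add (hBc (m+2) q₁))).sub (i0.mul (hDc (m+2) q₁))).div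
            (hAc (m+2) q₁) (fun q hq => hAne (m+2) (by omega) q (hsub q hq))) ?_
        intro q hq
        exact (eq_div_iff (hAne (m+2) (by omega) q (hsub q hq))).2 (S2 (E q) q (hsub q hq) m)
  -- asymptotics
  have hK : t₁ * t₂ ≠ 0 := (mul_pos ht₁ ht₂).ne'
  have hAas : ∀ n, 1 ≤ n → As (A n) (h₁ + h₂) (t₁ * t₂) := fun n hn => fA_as hβ n hn
  set d : ℕ → ℝ := fun n => 2 * n - 1 + h₁ + h₂ - l₁ - l₂ - β with hd
  have hDas : ∀ n, n + 2 ≤ N + 1 → As (D (n+2)) (d (n+2)) 1 := fun n hn =>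
    fD_as hlam N hN hα (n+2) hn
  set b : ℕ → ℕ → ℝ := fun k n => 1/2 + h₁ + (if n < k then (n:ℝ) - k else 0) with hb
  set bb : ℕ → ℝ → ℕ → ℝ := fun k s n =>
    if n < k then -(s * t₁) else if n = k then (1 - s) * t₁ else t₁ with hbb
  have hble : ∀ k n, b k n ≤ 1/2 + h₁ := by
    intro k n
    simp only [hb]
    split_ifs with h
    · have : (n:ℝ) < k := by exact_mod_cast h
      linarith
    · linarith
  have hcond : ∀ k n, n + 2 ≤ N + 1 → b k (n+1) + b k (n+2) - (h₁ + h₂) < d (n+2) := by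
    intro k n _
    have e1 := hble k (n+1)
    have e2 := hble k (n+2)
    have e3 : (0:ℝ) ≤ n := Nat.cast_nonneg n
    simp only [hd]; push_cast
    linarith
  have hBas : ∀ (k : ℕ) (E : ℝ → ℝ) (s : ℝ), As E (3/2 - k + h₁ - lam) (-(s * t₁)) → ∀ n : ℕ, 1 ≤ n →
      As (fun q => E q * q ^ ((n:ℝ) - 1 + lam) + B0 n q) (b k n) (bb k s n) :=
    fun k E s hE n hn => full_B hlam hh hl hyp1 k E s hE n hn
  have hev1 : ∀ᶠ q : ℝ in nhdsWithin 0 (Ioi 0), q ∈ Ioo (0:ℝ) 1 := ev_Ioo one_pos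
  have T1 : ∀ E : ℝ → ℝ, ∀ᶠ q in nhdsWithin 0 (Ioi 0), (c 1 q).eval (E q) * A 1 q =
      E q * q ^ (((1:ℕ) : ℝ) - 1 + lam) + B0 1 q := by
    intro E
    filter_upwards [hev1] with q hq using S1 (E q) q hq
  have T2 : ∀ E : ℝ → ℝ, ∀ n : ℕ, ∀ᶠ q in nhdsWithin 0 (Ioi 0),
      (c (n+2) q).eval (E q) * A (n+2) q =
      (c (n+1) q).eval (E q) * (E q * q ^ (((n+2:ℕ) : ℝ) - 1 + lam) + B0 (n+2) q)
        - (c n q).eval (E q) * D (n+2) q := by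
    intro E n
    filter_upwards [hev1] with q hq using S2 (E q) q hq n
  have F : ∀ (k : ℕ) (E : ℝ → ℝ) (s : ℝ), As E (3/2 - k + h₁ - lam) (-(s * t₁)) → ∀ n, n ≤ N + 1 →
      As (fun q => (c n q).eval (E q)) (∑ i ∈ Finset.range n, (b k (i+1) - (h₁ + h₂)))
        (∏ i ∈ Finset.range n, bb k s (i+1) / (t₁ * t₂)) := by
    intro k E s hE
    exact fwd (fun n q => (c n q).eval (E q)) A
      (fun n q => E q * q ^ ((n:ℝ) - 1 + lam) + B0 n q) D (h₁ + h₂) (t₁ * t₂) (b k) d (bb k s)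
      (N+1) hK hAas (fun n hn _ => hBas k E s hE n hn) hDas (hcond k) (fun q => by simp [hc0])
      (T1 E) (T2 E)
  -- the eigenvalues
  obtain ⟨q₁, hq₁, -, σ, hσ⟩ := zeros (fun q => c (N+1) q) (N+1) (fun _ => -t₁)
    (fun j => 3/2 - j + h₁ - lam) (fun _ => by simpa using ht₁.ne')
    (by
      intro i j _ hij _
      have : (i:ℝ) < j := by exact_mod_cast hij
      linarith) 1 one_pos (fun q hq => hdeg q hq (N+1))
    (by
      intro j _ _ s
      refine hcc 1 le_rfl (fun q => s * -t₁ * q ^ ((3:ℝ)/2 - j + h₁ - lam)) ?_ (N+1)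
      exact continuousOn_const.mul (hpc _ 1))
    (by
      intro j hj1 hj2 s s' hs0 hs1 hs'
      have hE : ∀ s : ℝ, As (fun q : ℝ => s * -t₁ * q ^ ((3:ℝ)/2 - j + h₁ - lam))
          (3/2 - j + h₁ - lam) (-(s * t₁)) := fun s =>
        ((As.const (s * -t₁)).mul (As.rpow _)).cast (by ring) (by ring)
      refine ((F j _ s (hE s) (N+1) le_rfl).mul (F j _ s' (hE s') (N+1) le_rfl)).ev_neg ?_
      rw [← Finset.prod_mul_distrib,
        ← Finset.mul_prod_erase _ _ (Finset.mem_range.2 (show j - 1 < N + 1 by omega))]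
      refine mul_neg_of_neg_of_pos ?_ (Finset.prod_pos ?_)
      · simp only [hbb, show j - 1 + 1 = j by omega, lt_irrefl, if_false, if_true]
        have : (1 - s) * t₁ / (t₁ * t₂) * ((1 - s') * t₁ / (t₁ * t₂)) =
          -(((1 - s) * (s' - 1)) * (t₁ / (t₁ * t₂))^2) := by ring
        rw [this, neg_lt_zero]
        have : 0 < 1 - s := by linarith
        have : 0 < s' - 1 := by linarith
        positivity
      · intro i hi
        have hij : i + 1 ≠ j := fun h => (Finset.mem_erase.1 hi).1 (by omega)
        simp only [hbb, if_neg hij]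
        split_ifs
        · have : -(s * t₁) / (t₁ * t₂) * (-(s' * t₁) / (t₁ * t₂)) =
            s * s' * (t₁ / (t₁ * t₂))^2 := by ring
          rw [this]
          have : 0 < s' := by linarith
          positivity
        · positivity)
  obtain ⟨hσc, -, -, hσu⟩ := hσ k hk1 hk2
  have hEvAs : As Ev (3/2 - k + h₁ - lam) (-(1 * t₁)) := by
    have := hEasym.mul_const (-t₁)
    rw [one_mul] at this
    rw [one_mul]
    refine Tendsto.congr' ?_ this
    filter_upwards [ev_pos] with q hq
    have := Real.rpow_pos_of_pos hq (3/2 - (k:ℝ) + h₁ - lam)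
    rw [Real.rpow_neg hq.le]
    field_simp
  have hEvnear : ∀ᶠ q : ℝ in nhdsWithin 0 (Ioi 0),
      Ev q / (-(q ^ ((3 : ℝ)/2 - (k : ℝ) + h₁ - lam) * t₁)) ∈ Icc (1/2:ℝ) (3/2) :=
    hEasym (Icc_mem_nhds (by norm_num) (by norm_num))
  obtain ⟨r, hr0, hr⟩ := mem_nhdsGT_iff_exists_Ioo_subset.1 hEvnear
  have hr0 : 0 < r := hr0
  set q₂ := min r q₁ with hq₂
  have hq₂0 : 0 < q₂ := lt_min hr0 hq₁.1
  have hq₂1 : q₂ ≤ 1 := (min_le_right _ _).trans hq₁.2.le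
  have hEvc : ContinuousOn Ev (Ioo 0 q₂) := by
    refine ContinuousOn.congr (f := fun q => σ k q * -t₁ * q ^ ((3:ℝ)/2 - k + h₁ - lam))
      (((hσc.mono (fun q hq => ⟨hq.1, hq.2.trans_le (min_le_right _ _)⟩)).mul
        continuousOn_const).mul (hpc _ _)) ?_
    intro q hq
    have hq1 : q ∈ Ioo 0 q₁ := ⟨hq.1, hq.2.trans_le (min_le_right _ _)⟩
    have hqr := hr (⟨hq.1, hq.2.trans_le (min_le_left _ _)⟩ : q ∈ Ioo 0 r)
    have hp := Real.rpow_pos_of_pos hq.1 (3/2 - (k:ℝ) + h₁ - lam)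
    have heq : Ev q / (-(q ^ ((3 : ℝ)/2 - (k : ℝ) + h₁ - lam) * t₁)) * -t₁ *
        q ^ ((3:ℝ)/2 - k + h₁ - lam) = Ev q := by
      generalize q ^ ((3 : ℝ)/2 - (k : ℝ) + h₁ - lam) = y at hp
      field_simp
    have := hσu q hq1 _ hqr (by
      rw [heq]; exact hEroot q ⟨hq.1, hq.2.trans_le hq₂1⟩)
    simp only
    rw [← this, heq]
  -- the zeros of the Heun polynomial
  set e : ℕ → ℝ := fun m => if m < k then (k:ℝ) - m - 1/2 + h₂ else
    -2 * (m:ℝ) - 1/2 - h₂ + l₁ + l₂ + β with he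
  set κ : ℕ → ℝ := fun m => if m < k then t₂ else -t₁ with hκ
  have hκ0 : ∀ i, κ i ≠ 0 := by
    intro i; simp only [hκ]; split_ifs
    · exact ht₂.ne'
    · simpa using ht₁.ne'
  have hemono : ∀ i j, 1 ≤ i → i < j → j ≤ N → e j < e i := by
    intro i j hi hij _
    have h1 : (i:ℝ) + 1 ≤ j := by exact_mod_cast hij
    have h2 : (1:ℝ) ≤ i := by exact_mod_cast hi
    simp only [he]
    split_ifs with h3 h4 h4
    · linarith
    · omega
    · have : (i:ℝ) + 1 ≤ k := by exact_mod_cast h4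
      linarith
    · linarith
  have hbwd := bwd (fun n q => (c n q).eval (Ev q)) A
      (fun n q => Ev q * q ^ ((n:ℝ) - 1 + lam) + B0 n q) D (h₁ + h₂) (t₁ * t₂) (b k) d (bb k 1)
      N k hAas (fun n hn _ => hBas k Ev 1 hEvAs n hn)
      (by
        intro n hn
        simp only [hbb]
        rw [if_neg (by omega), if_neg (by omega)]
        exact ht₁.ne') hDas (hcond k) (T2 Ev)
      (by filter_upwards [hev1] with q hq using hEroot q hq)
  have hu : ∀ n, n ≤ N → As (fun q => (c n q).eval (Ev q)) (∑ i ∈ Finset.range n, (-e (i+1)))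
      (∏ i ∈ Finset.range n, (-(κ (i+1))⁻¹)) := by
    intro n
    induction n with
    | zero => intro _; simpa [hc0] using As.const 1
    | succ m ih =>
      intro hm
      by_cases hmk : m + 1 < k
      · refine (F k Ev 1 hEvAs (m+1) (by omega)).cast (Finset.sum_congr rfl ?_)
          (Finset.prod_congr rfl ?_)
        · intro i hi
          have : i + 1 < k := by have := Finset.mem_range.1 hi; omega
          simp only [hb, he, if_pos this]; push_cast; ring
        · intro i hi
          have : i + 1 < k := by have := Finset.mem_range.1 hi; omega
          simp only [hbb, hκ, if_pos this]; field_simp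
      · obtain ⟨w, hw, hw'⟩ := hbwd (N - m - 1) m (by omega) (by omega)
        have hbv : bb k 1 (m+2) = t₁ := by
          simp only [hbb]
          rw [if_neg (by omega), if_neg (by omega)]
        have hw0 : bb k 1 (m+2) ≠ 0 := by rw [hbv]; exact ht₁.ne'
        refine (((ih (by omega)).mul (hw.inv hw0)).congr ?_).cast ?_ ?_
        · filter_upwards [hw', hw.ev_ne hw0] with q h1 h2
          rw [h1]; field_simp
        · rw [Finset.sum_range_succ]
          congr 1
          simp only [hb, hd, he, if_neg hmk, if_neg (show ¬ (m + 2 < k) by omega)]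
          push_cast; ring
        · rw [Finset.prod_range_succ, hbv]
          simp only [hκ, if_neg hmk, inv_neg, neg_neg]
  obtain ⟨q₃, hq₃, hq₃2, τ, hτ⟩ := zeros
    (fun q => ∑ n ∈ Finset.range (N+1), C ((c n q).eval (Ev q)) * X ^ n) N κ e hκ0 hemono q₂ hq₂0
    (by
      intro q _
      refine natDegree_sum_le_of_forall_le _ _ ?_
      intro n hn
      exact (natDegree_C_mul_X_pow_le _ _).trans (by have := Finset.mem_range.1 hn; omega))
    (by
      intro j _ _ s
      simp only [eval_finsetSum, eval_mul, eval_C, eval_pow, eval_X]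
      refine continuousOn_finsetSum _ (fun n _ => ?_)
      exact (hcc q₂ hq₂1 Ev hEvc n).mul ((continuousOn_const.mul (hpc _ _)).pow n))
    (by
      intro j hj1 hj2 s s' hs0 hs1 hs'
      obtain ⟨p, rfl⟩ : ∃ p, j = p + 1 := ⟨j - 1, by omega⟩
      have n1 := newton _ N e κ hemono hκ0 hu p hj2 s
      have n2 := newton _ N e κ hemono hκ0 hu p hj2 s'
      simp only [eval_finsetSum, eval_mul, eval_C, eval_pow, eval_X]
      refine (n1.mul n2).ev_neg ?_
      set G := ∏ i ∈ Finset.range p, (-(κ (i+1))⁻¹) with hG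
      have hG0 : G ≠ 0 := Finset.prod_ne_zero_iff.2
        (fun i _ => neg_ne_zero.2 (inv_ne_zero (hκ0 _)))
      have hk0 := hκ0 (p+1)
      have : G * (s * κ (p+1)) ^ p * (1 - s) * (G * (s' * κ (p+1)) ^ p * (1 - s')) =
        -((G * κ (p+1) ^ p) ^ 2 * (s * s') ^ p * ((1 - s) * (s' - 1))) := by
        rw [mul_pow, mul_pow, mul_pow]; ring
      rw [this, neg_lt_zero]
      have : 0 < s' := by linarith
      have : 0 < 1 - s := by linarith
      have : 0 < s' - 1 := by linarith
      have : 0 < (G * κ (p+1) ^ p) ^ 2 := by positivity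
      positivity)
  refine ⟨q₃, hq₃, fun j q => if j < k then τ (k - j) q * κ (k - j) * q ^ e (k - j) else
    τ j q * κ j * q ^ e j, ?_, ?_, ?_, ?_⟩
  · intro j hj1 hj2
    by_cases hjk : j < k
    · simp only [if_pos hjk]
      exact ((hτ (k-j) (by omega) (by omega)).1.mul continuousOn_const).mul (hpc _ _)
    · simp only [if_neg hjk]
      exact ((hτ j hj1 hj2).1.mul continuousOn_const).mul (hpc _ _)
  · intro q hq j hj1 hj2
    by_cases hjk : j < k
    · have := (hτ (k-j) (by omega) (by omega)).2.1 q hq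
      simp only [eval_finsetSum, eval_mul, eval_C, eval_pow, eval_X] at this
      simpa only [if_pos hjk] using this
    · have := (hτ j hj1 hj2).2.1 q hq
      simp only [eval_finsetSum, eval_mul, eval_C, eval_pow, eval_X] at this
      simpa only [if_neg hjk] using this
  · intro j hj1 hjk
    refine Tendsto.congr' ?_ (hτ (k-j) (by omega) (by omega)).2.2.1
    filter_upwards [ev_pos] with q hq
    have h1 : e (k - j) = (j:ℝ) - 1/2 + h₂ := by
      simp only [he, if_pos (show k - j < k by omega)]
      rw [Nat.cast_sub hjk.le]; ring
    have h2 : κ (k - j) = t₂ := by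
      simp only [hκ, if_pos (show k - j < k by omega)]
    have hp := Real.rpow_pos_of_pos hq ((j:ℝ) - 1/2 + h₂)
    rw [if_pos hjk, h1, h2]
    field_simp
  · intro j hjk hjN
    refine Tendsto.congr' ?_ (hτ j (by omega) hjN).2.2.1
    filter_upwards [ev_pos] with q hq
    have h1 : e j = -2 * (j:ℝ) - 1/2 - h₂ + l₁ + l₂ + β := by
      simp only [he, if_neg (show ¬ j < k by omega)]
    have h2 : κ j = -t₁ := by
      simp only [hκ, if_neg (show ¬ j < k by omega)]
    have hp := Real.rpow_pos_of_pos hq (-2 * (j:ℝ) - 1/2 - h₂ + l₁ + l₂ + β)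
    rw [if_neg (by omega), h1, h2]
    field_simp
end
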